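/- arXiv:1804.05269 — 4 statements merged into one kernel-verified Lean document; each statement's English description precedes it below -/
import Mathlib

section
/- Let G = F₂ be the free group with free generators a, b, let 2 = {0, 1}, and let u₂ be the uniform measure on 2. Set (X_L, μ_L) = (2^G × 2^G, u₂^G × u₂^G) and (X_R, μ_R) = (2^G × 2^G, u₂^G × u₂^G), each with the diagonal shift action of G. Define ψ : 2^G → 2^G × 2^G by ψ(x)(g) = (x(g) + x(ga) mod 2, x(g) + x(gb) mod 2) and φ : X_R → X_L by φ(x₃, x₄) = ψ(x₃). Then λ = (φ × id)_*(μ_R) is a joining of μ_L with μ_R, and there is a weak*-open neighborhood U of λ in the space of Borel probability measures on X_L × X_R containing no measure of the form (id × f)_*(μ_L), where f is a factor map from G ↷ (X_L, μ_L) onto G ↷ (X_R, μ_R). Consequently, the set of such factor joinings is not dense in the space of joinings of μ_L with μ_R. -/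
open MeasureTheory
open scoped ENNReal

instance : Countable (FreeGroup (Fin 2)) := FreeGroup.toWord_injective.countable

/-- The free group on two generators. -/
abbrev Ftwo := FreeGroup (Fin 2)

/-- The first free generator `a`. -/
def genA : Ftwo := FreeGroup.of 0

/-- The second free generator `b`. -/
def genB : Ftwo := FreeGroup.of 1

/-- The Bernoulli shift action of a group `G` on `L^G`: `(g • x)(t) = x(g⁻¹ t)`. -/
def shiftAct {G L : Type*} [Group G] (g : G) (x : G → L) : G → L :=
  fun t => x (g⁻¹ * t)

/-- The configuration space `2^G` for `G = F₂`, with `2 = Bool`. -/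
abbrev Cfg := Ftwo → Bool

/-- The diagonal shift action on `2^G × 2^G`. -/
def prodShift (g : Ftwo) : Cfg × Cfg → Cfg × Cfg :=
  fun y => (shiftAct g y.1, shiftAct g y.2)

/-- The uniform measure `u₂` on `2 = Bool`. -/
noncomputable def unifBool : Measure Bool := (2 : ℝ≥0∞)⁻¹ • Measure.count

/-- `ν` is the Bernoulli product measure `λ^G` on `L^G`. -/
def IsBernoulliProd {G L : Type*} [MeasurableSpace L] (lam : Measure L)
    (ν : Measure (G → L)) : Prop :=
  IsProbabilityMeasure ν ∧
    ∀ (s : Finset G) (f : G → Set L), (∀ g, MeasurableSet (f g)) →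
      ν {x | ∀ g ∈ s, x g ∈ f g} = ∏ g ∈ s, lam (f g)

/-- The Ornstein–Weiss map `ψ : 2^G → 2^G × 2^G`,
`ψ(x)(g) = (x(g) + x(ga), x(g) + x(gb)) mod 2`. -/
def psiOW : Cfg → Cfg × Cfg :=
  fun x => (fun g => xor (x g) (x (g * genA)), fun g => xor (x g) (x (g * genB)))

/-- `f` is a factor map from `(2^G × 2^G, μL)` onto `(2^G × 2^G, μR)` for the diagonal
shift actions. -/
def IsFactorMap (μL μR : Measure (Cfg × Cfg)) (f : Cfg × Cfg → Cfg × Cfg) : Prop :=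
  Measurable f ∧ (∀ᵐ x ∂μL, ∀ g : Ftwo, f (prodShift g x) = prodShift g (f x)) ∧
    Measure.map f μL = μR

/-- The Walsh character of `2^ι` attached to a finite set of coordinates. -/
def walsh {ι : Type*} (S : Finset ι) : C(ι → Bool, ℝ) where
  toFun x := ∏ i ∈ S, cond (x i) (-1) 1
  continuous_toFun := continuous_finsetProd _ fun i _ =>
    (continuous_of_discreteTopology (f := fun b : Bool => cond b (-1 : ℝ) 1)).comp
      (continuous_apply i)

theorem walsh_apply {ι : Type*} (S : Finset ι) (x : ι → Bool) :
    walsh S x = ∏ i ∈ S, cond (x i) (-1 : ℝ) 1 := rfl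

theorem walsh_mul_walsh {ι : Type*} [DecidableEq ι] (S T : Finset ι) :
    walsh S * walsh T = walsh (symmDiff S T) := by
  ext x
  have hsq : ∀ U : Finset ι, walsh U x * walsh U x = 1 := fun U => by
    simp only [walsh_apply, ← Finset.prod_mul_distrib]
    exact Finset.prod_eq_one fun i _ => by cases x i <;> simp
  have hS : walsh S x = walsh (S \ T) x * walsh (S ∩ T) x := by
    have := Finset.prod_sdiff (f := fun i => cond (x i) (-1 : ℝ) 1)
      (Finset.inter_subset_left (s₁ := S) (s₂ := T))
    rw [Finset.sdiff_inter_self_left] at this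
    exact this.symm
  have hT : walsh T x = walsh (T \ S) x * walsh (S ∩ T) x := by
    have := Finset.prod_sdiff (f := fun i => cond (x i) (-1 : ℝ) 1)
      (Finset.inter_subset_right (s₁ := S) (s₂ := T))
    rw [Finset.sdiff_inter_self_right] at this
    exact this.symm
  have hU : walsh (symmDiff S T) x = walsh (S \ T) x * walsh (T \ S) x :=
    Finset.prod_union (disjoint_sdiff_sdiff (x := S) (y := T))
  rw [ContinuousMap.mul_apply, hU, hS, hT]
  linear_combination walsh (S \ T) x * walsh (T \ S) x * hsq (S ∩ T)

theorem span_walsh_closure_eq_top {ι : Type*} :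
    (Submodule.span ℝ (Set.range (walsh (ι := ι)))).topologicalClosure = ⊤ := by
  classical
  have hadj : Subalgebra.toSubmodule (Algebra.adjoin ℝ (Set.range (walsh (ι := ι)))) =
      Submodule.span ℝ (Set.range walsh) := by
    refine Algebra.adjoin_eq_span_of_subset _
      (Set.Subset.trans (fun x hx => ?_) Submodule.subset_span)
    refine Submonoid.closure_induction (fun _ => id) ⟨∅, ?_⟩ ?_ hx
    · ext x
      simp [walsh_apply]
    · rintro - - - - ⟨S, rfl⟩ ⟨T, rfl⟩
      exact ⟨symmDiff S T, (walsh_mul_walsh S T).symm⟩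
  have hsep : (Algebra.adjoin ℝ (Set.range (walsh (ι := ι)))).SeparatesPoints := by
    intro x y hxy
    obtain ⟨i, hi⟩ := Function.ne_iff.mp hxy
    refine ⟨_, ⟨walsh {i}, Algebra.subset_adjoin ⟨{i}, rfl⟩, rfl⟩, ?_⟩
    simp only [walsh_apply, Finset.prod_singleton]
    revert hi
    cases x i <;> cases y i <;> norm_num
  rw [← hadj]
  exact congr_arg Subalgebra.toSubmodule
    (ContinuousMap.subalgebra_topologicalClosure_eq_top_of_separatesPoints _ hsep)

section Walsh

variable {ι : Type*} [Countable ι] (μ : Measure (ι → Bool))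

theorem integral_walsh_eq_zero
    (hμ : ∀ y : ι → Bool, MeasurePreserving (fun x i => xor (x i) (y i)) μ μ)
    {S : Finset ι} (hS : S.Nonempty) : ∫ x, walsh S x ∂μ = 0 := by
  classical
  obtain ⟨s, hs⟩ := hS
  have hflip : ∀ x : ι → Bool, walsh S (fun i => xor (x i) (decide (i = s))) = - walsh S x := by
    intro x
    simp only [walsh_apply]
    rw [← Finset.mul_prod_erase S _ hs, ← Finset.mul_prod_erase S _ hs, ← neg_mul]
    congr 1
    · cases x s <;> simp
    · exact Finset.prod_congr rfl fun i hi => by simp [Finset.ne_of_mem_erase hi]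
  have hf := hμ fun i => decide (i = s)
  have h := integral_map (μ := μ) hf.measurable.aemeasurable
    (f := walsh S) (walsh S).continuous.aestronglyMeasurable
  rw [hf.map_eq] at h
  simp only [hflip, integral_neg] at h
  linarith

theorem orthonormal_walsh [IsProbabilityMeasure μ]
    (hμ : ∀ y : ι → Bool, MeasurePreserving (fun x i => xor (x i) (y i)) μ μ) :
    Orthonormal ℝ fun S : Finset ι => ContinuousMap.toLp (E := ℝ) 2 μ ℝ (walsh S) := by
  classical
  rw [orthonormal_iff_ite]
  intro S T
  rw [ContinuousMap.inner_toLp]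
  have hmul : ∀ x, walsh T x * walsh S x = walsh (symmDiff T S) x := fun x => by
    rw [← walsh_mul_walsh, ContinuousMap.mul_apply]
  simp only [conj_trivial, hmul]
  split_ifs with h
  · simp [h, walsh_apply]
  · refine integral_walsh_eq_zero μ hμ (Finset.nonempty_iff_ne_empty.mpr fun h0 => h ?_)
    exact (symmDiff_eq_bot.mp h0).symm

/-- Parseval's identity for the Walsh characters. -/
theorem hasSum_walsh_coeff_sq [IsProbabilityMeasure μ]
    (hμ : ∀ y : ι → Bool, MeasurePreserving (fun x i => xor (x i) (y i)) μ μ)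
    {F : (ι → Bool) → ℝ} (hF : MemLp F 2 μ) :
    HasSum (fun S : Finset ι => (∫ x, walsh S x * F x ∂μ) ^ 2) (∫ x, F x ^ 2 ∂μ) := by
  have hdense : ⊤ ≤ (Submodule.span ℝ (Set.range fun S : Finset ι =>
      ContinuousMap.toLp (E := ℝ) 2 μ ℝ (walsh S))).topologicalClosure := by
    have h := (ContinuousMap.toLp_denseRange ℝ μ ℝ
      (by norm_num : (2 : ℝ≥0∞) ≠ ∞)).topologicalClosure_map_submodule
        (span_walsh_closure_eq_top (ι := ι))
    rw [Submodule.map_span, ← Set.range_comp] at h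
    exact h.ge
  have hsum := (HilbertBasis.mk (orthonormal_walsh μ hμ) hdense).hasSum_inner_mul_inner
    (hF.toLp F) (hF.toLp F)
  have hinner : ∀ S : Finset ι, inner ℝ (ContinuousMap.toLp (E := ℝ) 2 μ ℝ (walsh S))
      (hF.toLp F) = ∫ x, walsh S x * F x ∂μ := fun S => by
    rw [L2.inner_def]
    refine integral_congr_ae ?_
    filter_upwards [hF.coeFn_toLp, ContinuousMap.coeFn_toLp (p := 2) (𝕜 := ℝ) μ (walsh S)]
      with x h1 h2
    simp only [h1, h2, RCLike.inner_apply, conj_trivial, mul_comm]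
  have hself : inner ℝ (hF.toLp F) (hF.toLp F) = ∫ x, F x ^ 2 ∂μ := by
    rw [L2.inner_def]
    refine integral_congr_ae ?_
    filter_upwards [hF.coeFn_toLp] with x h1
    simp only [h1, RCLike.inner_apply, conj_trivial, sq]
  rw [hself, HilbertBasis.coe_mk] at hsum
  refine hsum.congr_fun fun S => ?_
  rw [real_inner_comm, hinner, sq]

end Walsh

theorem exists_equivariant_of_free (G Y : Type*) [Group G] [MulAction G Y] :
    ∃ π : Y → G, ∀ y : Y, (∀ g : G, g • y = y → g = 1) → ∀ h : G, π (h • y) = h * π y := by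
  let r : Y → Y := fun y => (Quotient.mk (MulAction.orbitRel G Y) y).out
  have hr : ∀ y : Y, ∃ g : G, g • r y = y := fun y => by
    have h : (MulAction.orbitRel G Y) (r y) y := Quotient.mk_out (s := MulAction.orbitRel G Y) y
    exact (MulAction.orbitRel G Y).symm h
  choose π hπ using hr
  refine ⟨π, fun y hy h => ?_⟩
  have hry : r (h • y) = r y :=
    congrArg Quotient.out (Quotient.sound (s := MulAction.orbitRel G Y) ⟨h, rfl⟩)
  have h1 : π (h • y) • r y = h • y := by rw [← hry]; exact hπ (h • y)
  have h2 : (π y)⁻¹ • y = r y := inv_smul_eq_iff.mpr (hπ y).symm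
  have h3 := hy (h⁻¹ * (π (h • y) * (π y)⁻¹)) (by rw [mul_smul, mul_smul, h2, h1, inv_smul_smul])
  rw [inv_mul_eq_one] at h3
  exact mul_inv_eq_iff_eq_mul.mp h3.symm

open scoped Pointwise in
theorem eq_one_of_smul_finset_eq {G : Type*} [Group G] [IsMulTorsionFree G] [DecidableEq G]
    {S : Finset G} (hS : S.Nonempty) {g : G} (h : g • S = S) : g = 1 := by
  have hfin := MulAction.stabilizer_finite (G := G) (s := (S : Set G)) hS S.finite_toSet
  have hg : g ∈ MulAction.stabilizer G (S : Set G) := by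
    rw [MulAction.mem_stabilizer_iff, ← Finset.coe_smul_finset, h]
  have : Finite (MulAction.stabilizer G (S : Set G)) := hfin
  have hord := isOfFinOrder_of_finite (⟨g, hg⟩ : MulAction.stabilizer G (S : Set G))
  by_contra hne
  exact not_isOfFinOrder_of_isMulTorsionFree hne
    ((MulAction.stabilizer G (S : Set G)).subtype.isOfFinOrder hord)

section Paradox

variable {Y : Type*} [MulAction (FreeGroup (Fin 2)) Y] {π : Y → FreeGroup (Fin 2)} {c : Y → ℝ}

/-- A square-summable function equivariantly indexed by the free group has, up to its variation
along a free generator, its mass on the words starting with a power of that generator. -/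
theorem tsum_sq_le_of_equivariant_generator
    (hπ : ∀ y, c y ≠ 0 → ∀ g : FreeGroup (Fin 2), π (g • y) = g * π y)
    (hc : Summable fun y => c y ^ 2) (i : Fin 2)
    (hD : Summable fun y => (c ((FreeGroup.of i)⁻¹ • y) - c y) ^ 2) :
    ∑' y, c y ^ 2 ≤
      3 / 2 * ∑' y, {y | ∃ s, π y ∈ FreeGroup.startsWith (i, s)}.indicator (fun y => c y ^ 2) y +
      3 * ∑' y, (c ((FreeGroup.of i)⁻¹ • y) - c y) ^ 2 := by
  classical
  set A : Set Y := {y | π y ∈ FreeGroup.startsWith (i, true)}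
  set B : Set Y := {y | π y ∈ FreeGroup.startsWith (i, false)}
  have hAB : Disjoint A B := Set.disjoint_left.mpr fun y hA hB =>
    Set.disjoint_left.mp (FreeGroup.startsWith.disjoint_iff_ne.mpr (by simp)) hA hB
  have hU : {y | ∃ s, π y ∈ FreeGroup.startsWith (i, s)} = A ∪ B := by
    ext y
    simp [A, B, or_comm]
  have hsA := hc.indicator A
  have hsB := hc.indicator B
  have hcA : Summable fun y => A.indicator (fun y => c ((FreeGroup.of i)⁻¹ • y) ^ 2) y :=
    Summable.indicator (((MulAction.toPerm (FreeGroup.of i)⁻¹ : Equiv.Perm Y).summable_iff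
      (f := fun y => c y ^ 2)).mpr hc) A
  set v : Y → ℝ := fun y => A.indicator (fun y => c ((FreeGroup.of i)⁻¹ • y) ^ 2) y with hv
  have hvs : Summable fun y => v (FreeGroup.of i • y) :=
    (MulAction.toPerm (FreeGroup.of i) : Equiv.Perm Y).summable_iff.mpr hcA
  have hvt : ∑' y, v (FreeGroup.of i • y) = ∑' y, v y :=
    (MulAction.toPerm (FreeGroup.of i) : Equiv.Perm Y).tsum_eq v
  have hcover : ∑' y, c y ^ 2 ≤
      ∑' y, (B.indicator (fun y => c y ^ 2) y + v (FreeGroup.of i • y)) := by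
    refine hc.tsum_le_tsum (fun y => ?_) (hsB.add hvs)
    have hv0 : 0 ≤ v (FreeGroup.of i • y) := Set.indicator_nonneg (fun _ _ => sq_nonneg _) _
    by_cases h0 : c y = 0
    · rw [h0]
      have := Set.indicator_nonneg (s := B) (f := fun y => c y ^ 2) (fun _ _ => sq_nonneg _) y
      simp only [ne_eq, OfNat.ofNat_ne_zero, not_false_eq_true, zero_pow]
      linarith
    by_cases hB : y ∈ B
    · rw [Set.indicator_of_mem hB]
      linarith
    · have hA : FreeGroup.of i • y ∈ A := by
        have := FreeGroup.startsWith_mk_mul (w := (i, true)) (π y) hB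
        simpa [A, hπ y h0, FreeGroup.of] using this
      rw [Set.indicator_of_notMem hB, hv]
      simp only [Set.indicator_of_mem hA, inv_smul_smul, zero_add, le_refl]
  have hcompare : ∑' y, v y ≤
      ∑' y, (3 / 2 * A.indicator (fun y => c y ^ 2) y +
        3 * (c ((FreeGroup.of i)⁻¹ • y) - c y) ^ 2) := by
    refine hcA.tsum_le_tsum (fun y => ?_) ((hsA.mul_left _).add (hD.mul_left _))
    by_cases hA : y ∈ A
    · simp only [hv, Set.indicator_of_mem hA]
      nlinarith [sq_nonneg (2 * c ((FreeGroup.of i)⁻¹ • y) - 3 * c y)]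
    · simp only [hv, Set.indicator_of_notMem hA]
      positivity
  have hunion : ∑' y, (A ∪ B).indicator (fun y => c y ^ 2) y =
      ∑' y, A.indicator (fun y => c y ^ 2) y + ∑' y, B.indicator (fun y => c y ^ 2) y := by
    rw [← hsA.tsum_add hsB]
    exact tsum_congr fun y => congrFun (Set.indicator_union_of_disjoint hAB _) y
  have hB0 : 0 ≤ ∑' y, B.indicator (fun y => c y ^ 2) y :=
    tsum_nonneg fun y => Set.indicator_nonneg (fun _ _ => sq_nonneg _) y
  rw [hsB.tsum_add hvs, hvt] at hcover
  rw [(hsA.mul_left _).tsum_add (hD.mul_left _), tsum_mul_left, tsum_mul_left] at hcompare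
  rw [hU, hunion]
  linarith

/-- The Kesten-type inequality obtained from the paradoxical decomposition of the free group. -/
theorem tsum_sq_le_of_equivariant
    (hπ : ∀ y, c y ≠ 0 → ∀ g : FreeGroup (Fin 2), π (g • y) = g * π y)
    (hc : Summable fun y => c y ^ 2)
    (hD : ∀ i : Fin 2, Summable fun y => (c ((FreeGroup.of i)⁻¹ • y) - c y) ^ 2) :
    ∑' y, c y ^ 2 ≤ 6 * ∑ i : Fin 2, ∑' y, (c ((FreeGroup.of i)⁻¹ • y) - c y) ^ 2 := by
  have h0 := tsum_sq_le_of_equivariant_generator hπ hc 0 (hD 0)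
  have h1 := tsum_sq_le_of_equivariant_generator hπ hc 1 (hD 1)
  set E : Fin 2 → Set Y := fun i => {y | ∃ s, π y ∈ FreeGroup.startsWith (i, s)}
  have hdisj : Disjoint (E 0) (E 1) := by
    rw [Set.disjoint_left]
    rintro y ⟨s, hs⟩ ⟨t, ht⟩
    exact Set.disjoint_left.mp (FreeGroup.startsWith.disjoint_iff_ne.mpr (by simp)) hs ht
  have hle : ∑' y, (E 0).indicator (fun y => c y ^ 2) y +
      ∑' y, (E 1).indicator (fun y => c y ^ 2) y ≤ ∑' y, c y ^ 2 := by
    rw [← (hc.indicator _).tsum_add (hc.indicator _)]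
    refine ((hc.indicator _).add (hc.indicator _)).tsum_le_tsum (fun y => ?_) hc
    rw [← congrFun (Set.indicator_union_of_disjoint hdisj _) y]
    exact Set.indicator_le_self' (fun _ _ => sq_nonneg _) y
  rw [Fin.sum_univ_two]
  linarith

end Paradox

section Bernoulli

theorem unifBool_preimage_xor (b : Bool) (A : Set Bool) :
    unifBool ((fun c => xor c b) ⁻¹' A) = unifBool A := by
  have hinj : Function.Injective fun c : Bool => xor c b := fun c d h => by simpa using h
  simp only [unifBool, Measure.smul_apply]
  rw [Measure.count_apply MeasurableSet.of_discrete, Measure.count_apply MeasurableSet.of_discrete,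
    Set.encard_preimage_of_injective_subset_range hinj]
  exact fun c _ => ⟨xor c b, by simp⟩

theorem isProbabilityMeasure_unifBool : IsProbabilityMeasure unifBool :=
  ⟨by
    have h2 : ({false, true} : Set Bool).encard = 2 := Set.encard_pair (by simp)
    simp [unifBool, Measure.count_apply, h2, ENNReal.inv_mul_cancel]⟩

theorem measurable_xor_config {ι : Type*} :
    Measurable fun p : (ι → Bool) × (ι → Bool) => fun i => xor (p.1 i) (p.2 i) :=
  measurable_pi_lambda _ fun i =>
    have hpair : Measurable fun p : (ι → Bool) × (ι → Bool) => (p.1 i, p.2 i) :=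
      ((measurable_pi_apply i).comp measurable_fst).prodMk
        ((measurable_pi_apply i).comp measurable_snd)
    (measurable_of_finite fun q : Bool × Bool => xor q.1 q.2).comp hpair

theorem IsBernoulliProd.measurePreserving_xor {G : Type*} {μ : Measure (G → Bool)}
    (h : IsBernoulliProd unifBool μ) (y : G → Bool) :
    MeasurePreserving (fun x g => xor (x g) (y g)) μ μ := by
  have := isProbabilityMeasure_unifBool
  have hmeas : Measurable fun (x : G → Bool) g => xor (x g) (y g) :=
    measurable_xor_config.comp (measurable_id.prodMk measurable_const)
  refine ⟨hmeas, ?_⟩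
  rw [Measure.eq_infinitePi (fun _ => unifBool) (ν := μ) fun s t ht => h.2 s t ht]
  refine Measure.eq_infinitePi _ fun s t ht => ?_
  rw [← Measure.eq_infinitePi (fun _ => unifBool) (ν := μ) fun s t ht => h.2 s t ht,
    Measure.map_apply hmeas (MeasurableSet.pi s.countable_toSet fun i _ => ht i)]
  refine (h.2 s (fun g => (fun c => xor c (y g)) ⁻¹' t g)
    fun _ => MeasurableSet.of_discrete).trans ?_
  exact Finset.prod_congr rfl fun g _ => unifBool_preimage_xor _ _

end Bernoulli

/-- A left-invariant and a right-invariant probability measure for the same operation agree. -/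
theorem eq_of_measurePreserving_op {Z : Type*} [MeasurableSpace Z] {op : Z → Z → Z}
    (hop : Measurable (Function.uncurry op)) {ν m : Measure Z} [IsProbabilityMeasure ν]
    [IsProbabilityMeasure m] (hν : ∀ y, MeasurePreserving (fun x => op x y) ν ν)
    (hm : ∀ x, MeasurePreserving (op x) m m) : ν = m := by
  ext A hA
  have h1 : (ν.prod m) (Function.uncurry op ⁻¹' A) = m A := by
    rw [Measure.prod_apply (hop hA)]
    have : ∀ x, m (Prod.mk x ⁻¹' (Function.uncurry op ⁻¹' A)) = m A := fun x =>
      (hm x).measure_preimage hA.nullMeasurableSet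
    simp [this]
  have h2 : (ν.prod m) (Function.uncurry op ⁻¹' A) = ν A := by
    rw [Measure.prod_apply_symm (hop hA)]
    have : ∀ y, ν ((fun x => (x, y)) ⁻¹' (Function.uncurry op ⁻¹' A)) = ν A := fun y =>
      (hν y).measure_preimage hA.nullMeasurableSet
    simp [this]
  exact h2.symm.trans h1

theorem psiOW_shiftAct (g : Ftwo) (x : Cfg) : psiOW (shiftAct g x) = prodShift g (psiOW x) := by
  simp only [psiOW, prodShift]
  refine Prod.ext (funext fun t => ?_) (funext fun t => ?_) <;> simp [shiftAct, mul_assoc]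

theorem continuous_psiOW : Continuous psiOW := by
  have hxor : ∀ g s : Ftwo, Continuous fun x : Cfg => xor (x g) (x (g * s)) := fun g s =>
    have hpair : Continuous fun x : Cfg => (x g, x (g * s)) :=
      (continuous_apply g).prodMk (continuous_apply (g * s))
    (continuous_of_discreteTopology (f := fun q : Bool × Bool => xor q.1 q.2)).comp hpair
  exact (continuous_pi fun g => hxor g genA).prodMk (continuous_pi fun g => hxor g genB)

theorem psiOW_xor (x y : Cfg) : psiOW (fun g => xor (x g) (y g)) =
    (fun g => xor ((psiOW x).1 g) ((psiOW y).1 g),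
      fun g => xor ((psiOW x).2 g) ((psiOW y).2 g)) := by
  refine Prod.ext (funext fun g => ?_) (funext fun g => ?_) <;>
  · simp only [psiOW]
    rw [Bool.xor_assoc, Bool.xor_assoc, Bool.xor_left_comm (y g)]

/-- One step along a free generator of the skew product defined by a `ℤ/2`-valued cocycle. -/
def skewStep {G : Type*} [Group G] (s : G) (p : G → Bool) : Equiv.Perm (G × Bool) where
  toFun z := (z.1 * s, xor z.2 (p z.1))
  invFun z := (z.1 * s⁻¹, xor z.2 (p (z.1 * s⁻¹)))
  left_inv z := by simp
  right_inv z := by simp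

theorem psiOW_surjective : Function.Surjective psiOW := by
  rintro ⟨p, q⟩
  let ρ : Ftwo →* Equiv.Perm (Ftwo × Bool) :=
    FreeGroup.lift fun i => (skewStep (FreeGroup.of i) (![p, q] i))⁻¹
  have hof : ∀ i, ρ (FreeGroup.of i) = (skewStep (FreeGroup.of i) (![p, q] i))⁻¹ := fun i =>
    FreeGroup.lift_apply_of
  have hfst : ∀ g : Ftwo, ∀ z, ((ρ g)⁻¹ z).1 = z.1 * g := by
    intro g
    induction g using FreeGroup.induction_on with
    | C1 => simp
    | of i => intro z; rw [hof, inv_inv]; rfl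
    | inv_of i _ => intro z; rw [map_inv, hof, inv_inv]; rfl
    | mul g h hg hh =>
      intro z
      rw [map_mul, mul_inv_rev, Equiv.Perm.mul_apply, hh, hg, mul_assoc]
  let x : Cfg := fun g => ((ρ g)⁻¹ (1, false)).2
  have hx : ∀ g i, xor (x g) (x (g * FreeGroup.of i)) = (![p, q] i) g := by
    intro g i
    have : x (g * FreeGroup.of i) = xor (x g) ((![p, q] i) ((ρ g)⁻¹ (1, false)).1) := by
      simp only [x]
      rw [map_mul, mul_inv_rev, Equiv.Perm.mul_apply, hof, inv_inv]
      rfl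
    rw [this, hfst, one_mul]
    simp
  exact ⟨x, Prod.ext (funext fun g => hx g 0) (funext fun g => hx g 1)⟩

theorem measurePreserving_psiOW {μ : Measure Cfg} (h : IsBernoulliProd unifBool μ) :
    MeasurePreserving psiOW μ (μ.prod μ) := by
  have := h.1
  have hψ := continuous_psiOW.measurable
  have := Measure.isProbabilityMeasure_map (μ := μ) hψ.aemeasurable
  refine ⟨hψ, eq_of_measurePreserving_op (op := fun z w : Cfg × Cfg =>
    ((fun g => xor (z.1 g) (w.1 g), fun g => xor (z.2 g) (w.2 g)) : Cfg × Cfg)) ?_ ?_ ?_⟩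
  · exact (measurable_xor_config.comp ((measurable_fst.comp measurable_fst).prodMk
      (measurable_fst.comp measurable_snd))).prodMk
      (measurable_xor_config.comp ((measurable_snd.comp measurable_fst).prodMk
      (measurable_snd.comp measurable_snd)))
  · intro y
    obtain ⟨y, rfl⟩ := psiOW_surjective y
    have hxor := h.measurePreserving_xor y
    have hop : Measurable fun z : Cfg × Cfg => ((fun g => xor (z.1 g) ((psiOW y).1 g),
        fun g => xor (z.2 g) ((psiOW y).2 g)) : Cfg × Cfg) :=
      (measurable_xor_config.comp (measurable_fst.prodMk measurable_const)).prodMk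
        (measurable_xor_config.comp (measurable_snd.prodMk measurable_const))
    refine ⟨hop, ?_⟩
    conv_rhs => rw [← hxor.map_eq]
    rw [Measure.map_map hop hψ, Measure.map_map hψ hxor.measurable]
    exact congrArg (Measure.map · μ) (funext fun x => (psiOW_xor x y).symm)
  · intro x
    have hxor : ∀ y : Cfg, MeasurePreserving (fun x g => xor (y g) (x g)) μ μ := fun y => by
      simpa only [Bool.xor_comm] using h.measurePreserving_xor y
    exact (hxor x.1).prod (hxor x.2)

open scoped Pointwise in
theorem walsh_shiftAct {G : Type*} [Group G] [DecidableEq G] (S : Finset G) (g : G)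
    (x : G → Bool) : walsh S (shiftAct g⁻¹ x) = walsh (g • S) x := by
  rw [walsh_apply, walsh_apply, Finset.smul_finset_def,
    Finset.prod_image (MulAction.injective g).injOn]
  simp [shiftAct]

open scoped Pointwise in
/-- The spectral gap of the Bernoulli shift of the free group on two generators. -/
theorem integral_sq_le_of_integral_eq_zero {μ : Measure Cfg} (h : IsBernoulliProd unifBool μ)
    (hshift : ∀ g : Ftwo, MeasurePreserving (shiftAct (L := Bool) g) μ μ)
    {F : Cfg → ℝ} (hF : MemLp F 2 μ) (hF0 : ∫ x, F x ∂μ = 0) :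
    ∫ x, F x ^ 2 ∂μ ≤
      6 * ∑ i : Fin 2, ∫ x, (F (shiftAct (FreeGroup.of i)⁻¹ x) - F x) ^ 2 ∂μ := by
  have := h.1
  have hxor := h.measurePreserving_xor
  set c : Finset Ftwo → ℝ := fun S => ∫ x, walsh S x * F x ∂μ with hc
  have hint : ∀ (S : Finset Ftwo) {H : Cfg → ℝ}, MemLp H 2 μ →
      Integrable (fun x => walsh S x * H x) μ := fun S H hH => by
    refine (hH.integrable (by norm_num)).bdd_mul (c := 1)
      (walsh S).continuous.aestronglyMeasurable (Filter.Eventually.of_forall fun x => ?_)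
    rw [walsh_apply, norm_prod]
    exact (Finset.prod_eq_one fun i _ => by cases x i <;> simp).le
  have hcoeff : ∀ (g : Ftwo) S, ∫ x, walsh S x * F (shiftAct g x) ∂μ = c (g • S) := fun g S => by
    have hcongr : ∀ x, walsh S x * F (shiftAct g x) =
        walsh (g • S) (shiftAct g x) * F (shiftAct g x) := fun x => by
      rw [← walsh_shiftAct]
      congr 2
      funext t
      simp [shiftAct]
    simp only [hcongr, hc]
    have hm := integral_map (μ := μ) (hshift g).measurable.aemeasurable
      (f := fun x => walsh (g • S) x * F x)
      (by rw [(hshift g).map_eq]; exact (hint _ hF).aestronglyMeasurable)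
    rw [(hshift g).map_eq] at hm
    exact hm.symm
  have hD : ∀ i : Fin 2, HasSum (fun S => (c ((FreeGroup.of i)⁻¹ • S) - c S) ^ 2)
      (∫ x, (F (shiftAct (FreeGroup.of i)⁻¹ x) - F x) ^ 2 ∂μ) := fun i => by
    have hFi := hF.comp_measurePreserving (hshift (FreeGroup.of i)⁻¹)
    refine (hasSum_walsh_coeff_sq μ hxor (hFi.sub hF)).congr_fun fun S => ?_
    rw [← hcoeff, hc]
    simp only [Pi.sub_apply, mul_sub, Function.comp_apply]
    exact congrArg (· ^ 2) (integral_sub (hint S hFi) (hint S hF)).symm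
  have hsum := hasSum_walsh_coeff_sq μ hxor hF
  obtain ⟨π, hπ⟩ := exists_equivariant_of_free Ftwo (Finset Ftwo)
  have key := tsum_sq_le_of_equivariant (π := π) (c := c) (fun S hS g => hπ S (fun g hg => ?_) g)
    hsum.summable fun i => (hD i).summable
  · rw [hsum.tsum_eq] at key
    simpa only [(hD _).tsum_eq] using key
  · refine eq_one_of_smul_finset_eq (Finset.nonempty_iff_ne_empty.mpr ?_) hg
    rintro rfl
    exact hS (by simpa [hc, walsh_apply] using hF0)

/-- The pairs `(x, z)` such that `x` and `ψ(z₁)` agree at the identity. -/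
def agreeSet : Set ((Cfg × Cfg) × (Cfg × Cfg)) :=
  {w | (psiOW w.2.1).1 1 = w.1.1 1 ∧ (psiOW w.2.1).2 1 = w.1.2 1}

theorem isClopen_agreeSet : IsClopen agreeSet := by
  have hψ : Continuous fun w : (Cfg × Cfg) × (Cfg × Cfg) => psiOW w.2.1 :=
    continuous_psiOW.comp (continuous_fst.comp continuous_snd)
  have hdiag : IsClopen {q : Bool × Bool | q.1 = q.2} := isClopen_discrete _
  exact (hdiag.preimage (((continuous_apply 1).comp (continuous_fst.comp hψ)).prodMk
      ((continuous_apply 1).comp (continuous_fst.comp continuous_fst)))).inter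
    (hdiag.preimage (((continuous_apply 1).comp (continuous_snd.comp hψ)).prodMk
      ((continuous_apply 1).comp (continuous_snd.comp continuous_fst))))

theorem le_measure_not_mem_agreeSet {μ : Measure Cfg} (h : IsBernoulliProd unifBool μ)
    (hshift : ∀ g : Ftwo, MeasurePreserving (shiftAct (L := Bool) g) μ μ)
    {f : Cfg × Cfg → Cfg × Cfg} (hf : Measurable f)
    (hfeq : ∀ᵐ x ∂μ.prod μ, ∀ g : Ftwo, f (prodShift g x) = prodShift g (f x)) :
    1 / 48 ≤ (μ.prod μ).real ((fun x => (x, f x)) ⁻¹' agreeSetᶜ) := by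
  have := h.1
  have hψ := measurePreserving_psiOW h
  have hbad : MeasurableSet ((fun x => (x, f x)) ⁻¹' agreeSetᶜ) :=
    (measurable_id.prodMk hf) isClopen_agreeSet.isOpen.measurableSet.compl
  set B : Set Cfg := psiOW ⁻¹' ((fun x => (x, f x)) ⁻¹' agreeSetᶜ)
  have hBmeas : MeasurableSet B := hψ.measurable hbad
  have hBp : (μ.prod μ).real ((fun x => (x, f x)) ⁻¹' agreeSetᶜ) = μ.real B := by
    rw [measureReal_def, measureReal_def, hψ.measure_preimage hbad.nullMeasurableSet]
  set k : Ftwo → Cfg → Bool := fun g x => xor ((f (psiOW x)).1 g) (x g) with hk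
  set F : Cfg → ℝ := fun x => cond (k 1 x) (-1) 1 with hFdef
  have hkmeas : Measurable (k 1) :=
    (measurable_pi_apply 1).comp (measurable_xor_config.comp
      ((measurable_fst.comp (hf.comp hψ.measurable)).prodMk measurable_id))
  have hFmeas : Measurable F :=
    (measurable_of_finite fun b : Bool => cond b (-1 : ℝ) 1).fun_comp hkmeas
  have hF : MemLp F 2 μ := MemLp.of_bound hFmeas.aestronglyMeasurable 1
    (Filter.Eventually.of_forall fun x => by simp only [hFdef]; cases k 1 x <;> simp)
  have hF2 : ∫ x, F x ^ 2 ∂μ = 1 := by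
    have : ∀ x, F x ^ 2 = 1 := fun x => by simp only [hFdef]; cases k 1 x <;> simp
    simp [this]
  have hF0 : ∫ x, F x ∂μ = 0 := by
    have hflip := h.measurePreserving_xor fun _ => true
    have hneg : ∀ x : Cfg, F (fun g => xor (x g) true) = - F x := fun x => by
      have hpsi : psiOW (fun g => xor (x g) true) = psiOW x := by
        rw [psiOW_xor]
        simp [psiOW]
      simp only [hFdef, hk, hpsi]
      cases (f (psiOW x)).1 1 <;> cases x 1 <;> simp
    have hm := integral_map (μ := μ) hflip.measurable.aemeasurable
      (f := F) hFmeas.aestronglyMeasurable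
    rw [hflip.map_eq] at hm
    simp only [hneg, integral_neg] at hm
    linarith
  have hfψ : ∀ᵐ x ∂μ, ∀ g : Ftwo, f (prodShift g (psiOW x)) = prodShift g (f (psiOW x)) :=
    hψ.quasiMeasurePreserving.ae hfeq
  have hD : ∀ i : Fin 2,
      ∫ x, (F (shiftAct (FreeGroup.of i)⁻¹ x) - F x) ^ 2 ∂μ ≤ 4 * μ.real B := fun i => by
    have hle : ∫ x, (F (shiftAct (FreeGroup.of i)⁻¹ x) - F x) ^ 2 ∂μ ≤
        ∫ x, B.indicator (fun _ => (4 : ℝ)) x ∂μ := by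
      refine integral_mono_ae
        ((hF.comp_measurePreserving (hshift (FreeGroup.of i)⁻¹)).sub hF).integrable_sq
        ((integrable_const _).indicator hBmeas) ?_
      filter_upwards [hfψ] with x hx
      have hstep : k 1 (shiftAct (FreeGroup.of i)⁻¹ x) = k (FreeGroup.of i) x := by
        simp only [hk, psiOW_shiftAct, hx]
        simp [prodShift, shiftAct]
      by_cases hxB : x ∈ B
      · rw [Set.indicator_of_mem hxB]
        simp only [hFdef]
        cases k 1 (shiftAct (FreeGroup.of i)⁻¹ x) <;> cases k 1 x <;> norm_num
      · rw [Set.indicator_of_notMem hxB]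
        have hagree : (psiOW x, f (psiOW x)) ∈ agreeSet := by
          by_contra hcon
          exact hxB hcon
        have hi : xor ((f (psiOW x)).1 1) ((f (psiOW x)).1 (FreeGroup.of i)) =
            xor (x 1) (x (FreeGroup.of i)) := by
          obtain ⟨h1, h2⟩ := hagree
          simp only [psiOW, one_mul, genA, genB] at h1 h2
          fin_cases i
          · exact h1
          · exact h2
        have hkk : k (FreeGroup.of i) x = k 1 x := by
          simp only [hk]
          revert hi
          cases (f (psiOW x)).1 1 <;> cases (f (psiOW x)).1 (FreeGroup.of i) <;> cases x 1 <;>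
            cases x (FreeGroup.of i) <;> simp
        simp only [hFdef, hstep, hkk]
        simp
    rw [integral_indicator_const _ hBmeas, smul_eq_mul, mul_comm] at hle
    exact hle
  have hgap := integral_sq_le_of_integral_eq_zero h hshift hF hF0
  rw [hF2, Fin.sum_univ_two] at hgap
  rw [hBp]
  linarith [hD 0, hD 1]

/-- **Failure of the residual factor theorem for `F₂` (L. Bowen)**: with
`(X_L, μ_L) = (X_R, μ_R) = (2^{F₂} × 2^{F₂}, u₂^{F₂} × u₂^{F₂})` and
`φ(x₃, x₄) = ψ(x₃)` built from the Ornstein–Weiss map `ψ`, the measure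
`λ = (φ × id)_* μ_R` is a joining of `μ_L` with `μ_R` admitting a weak*-open neighborhood
containing no joining of the form `(id × f)_* μ_L` for a factor map `f`; consequently the
factor joinings are not dense in the space of joinings of `μ_L` with `μ_R`. -/
theorem residual_factor_theorem_fails_for_F2
    (mu2 : Measure Cfg) (h2 : IsBernoulliProd unifBool mu2) :
    (∀ g : Ftwo, MeasurePreserving (shiftAct (L := Bool) g) mu2 mu2) →
    ∀ muL muR : Measure (Cfg × Cfg), muL = mu2.prod mu2 → muR = mu2.prod mu2 →
    ∀ lam : Measure ((Cfg × Cfg) × (Cfg × Cfg)),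
      lam = Measure.map (fun z : Cfg × Cfg => ((fun w : Cfg × Cfg => psiOW w.1) z, z)) muR →
    ((∀ g : Ftwo, MeasurePreserving
        (fun w : (Cfg × Cfg) × (Cfg × Cfg) => (prodShift g w.1, prodShift g w.2)) lam lam) ∧
      Measure.map Prod.fst lam = muL ∧ Measure.map Prod.snd lam = muR) ∧
    (∃ U : Set (ProbabilityMeasure ((Cfg × Cfg) × (Cfg × Cfg))),
      IsOpen U ∧
      (∀ κ : ProbabilityMeasure ((Cfg × Cfg) × (Cfg × Cfg)),
        (κ : Measure ((Cfg × Cfg) × (Cfg × Cfg))) = lam → κ ∈ U) ∧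
      ∀ κ ∈ U, ¬ ∃ f : Cfg × Cfg → Cfg × Cfg, IsFactorMap muL muR f ∧
        (κ : Measure ((Cfg × Cfg) × (Cfg × Cfg))) =
          Measure.map (fun x : Cfg × Cfg => (x, f x)) muL) ∧
    (∀ hlam : IsProbabilityMeasure lam,
      (⟨lam, hlam⟩ : ProbabilityMeasure ((Cfg × Cfg) × (Cfg × Cfg))) ∉
        closure {κ : ProbabilityMeasure ((Cfg × Cfg) × (Cfg × Cfg)) |
          ∃ f : Cfg × Cfg → Cfg × Cfg, IsFactorMap muL muR f ∧
            (κ : Measure ((Cfg × Cfg) × (Cfg × Cfg))) =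
              Measure.map (fun x : Cfg × Cfg => (x, f x)) muL}) := by
  intro hshift muL muR hmuL hmuR lam hlam
  subst hmuL hmuR
  have := h2.1
  have hψ := measurePreserving_psiOW h2
  have hψfst : MeasurePreserving (fun w : Cfg × Cfg => psiOW w.1) (mu2.prod mu2) (mu2.prod mu2) :=
    hψ.comp measurePreserving_fst
  have hgraph : Measurable fun z : Cfg × Cfg => (psiOW z.1, z) :=
    hψfst.measurable.prodMk measurable_id
  have hprod : ∀ g : Ftwo, MeasurePreserving (prodShift g) (mu2.prod mu2) (mu2.prod mu2) :=
    fun g => (hshift g).prod (hshift g)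
  let U : Set (ProbabilityMeasure ((Cfg × Cfg) × (Cfg × Cfg))) := {κ | κ agreeSetᶜ < 1 / 48}
  have hUopen : IsOpen U := by
    have hcont : Continuous fun κ : ProbabilityMeasure ((Cfg × Cfg) × (Cfg × Cfg)) =>
        κ agreeSetᶜ := continuous_iff_continuousAt.mpr fun κ =>
      ProbabilityMeasure.tendsto_measure_of_isClopen_of_tendsto Filter.tendsto_id
        isClopen_agreeSet.compl
    exact isOpen_Iio.preimage hcont
  have hUmem : ∀ κ : ProbabilityMeasure ((Cfg × Cfg) × (Cfg × Cfg)),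
      (κ : Measure ((Cfg × Cfg) × (Cfg × Cfg))) = lam → κ ∈ U := fun κ hκ => by
    have hzero : (κ : Measure ((Cfg × Cfg) × (Cfg × Cfg))) agreeSetᶜ = 0 := by
      rw [hκ, hlam, Measure.map_apply hgraph isClopen_agreeSet.isOpen.measurableSet.compl]
      convert measure_empty (μ := mu2.prod mu2)
      ext z
      simp [agreeSet]
    have hκ0 : κ agreeSetᶜ = 0 := (ProbabilityMeasure.null_iff_toMeasure_null κ _).mpr hzero
    change κ agreeSetᶜ < 1 / 48
    rw [hκ0]
    norm_num
  have hUfactor : ∀ κ ∈ U, ¬ ∃ f : Cfg × Cfg → Cfg × Cfg,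
      IsFactorMap (mu2.prod mu2) (mu2.prod mu2) f ∧
        (κ : Measure ((Cfg × Cfg) × (Cfg × Cfg))) =
          Measure.map (fun x : Cfg × Cfg => (x, f x)) (mu2.prod mu2) := by
    rintro κ hκ ⟨f, ⟨hf, hfeq, -⟩, hκf⟩
    have hge := le_measure_not_mem_agreeSet h2 hshift hf hfeq
    have hid : Measurable fun x : Cfg × Cfg => (x, f x) := measurable_id.prodMk hf
    rw [measureReal_def, ← Measure.map_apply hid
      isClopen_agreeSet.isOpen.measurableSet.compl] at hge
    have hlt : ((κ agreeSetᶜ : NNReal) : ℝ) < 1 / 48 := by exact_mod_cast hκ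
    refine absurd hge (not_le.mpr (lt_of_eq_of_lt ?_ hlt))
    exact congrArg (fun ν : Measure _ => (ν agreeSetᶜ).toReal) hκf.symm
  refine ⟨⟨fun g => ?_, ?_, ?_⟩, ⟨U, hUopen, hUmem, hUfactor⟩, fun hprob hclosure => ?_⟩
  · have hmeas : Measurable fun w : (Cfg × Cfg) × (Cfg × Cfg) =>
        (prodShift g w.1, prodShift g w.2) :=
      ((hprod g).measurable.comp measurable_fst).prodMk
        ((hprod g).measurable.comp measurable_snd)
    refine ⟨hmeas, ?_⟩
    rw [hlam, Measure.map_map hmeas hgraph]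
    conv_rhs => rw [← (hprod g).map_eq, Measure.map_map hgraph (hprod g).measurable]
    exact congrArg (Measure.map · (mu2.prod mu2)) (funext fun z =>
      Prod.ext (psiOW_shiftAct g z.1).symm rfl)
  · rw [hlam, Measure.map_map measurable_fst hgraph]
    exact hψfst.map_eq
  · rw [hlam, Measure.map_map measurable_snd hgraph]
    exact Measure.map_id
  · obtain ⟨κ, hκU, hκ⟩ :=
      (mem_closure_iff (X := ProbabilityMeasure ((Cfg × Cfg) × (Cfg × Cfg)))).mp hclosure U hUopen
        (hUmem ⟨lam, hprob⟩ rfl)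
    exact hUfactor κ hκU hκ
end

section
/- Let G be a countable group, let G ↷ X be a Borel action on a standard Borel space, let F be a G-invariant sub-σ-algebra, and let T ∈ [E_G^X] be F-expressible. Then for every Borel set A ⊆ X, the image T(A) belongs to σ_G({A}) ∨ F, where σ_G({A}) is the smallest G-invariant sub-σ-algebra containing A. In particular, every G-invariant sub-σ-algebra containing F is T-invariant. -/
open MeasureTheory

/-- `T` belongs to the full group `[E_G^X]`: it is a (Borel) bijection of `X` moving each
point within its `G`-orbit. -/
def InFullGroup (G : Type*) {X : Type*} [Group G] [MulAction G X] [MeasurableSpace X]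
    (T : X ≃ X) : Prop :=
  Measurable T ∧ Measurable T.symm ∧ ∀ x : X, T x ∈ MulAction.orbit G x

/-- `T` is `F`-expressible: there is an `F`-measurable partition `{Q_g : g ∈ G}` of `X` with
`T x = g • x` for all `x ∈ Q_g`. -/
def Expressible (G : Type*) {X : Type*} [Group G] [MulAction G X]
    (F : MeasurableSpace X) (T : X ≃ X) : Prop :=
  ∃ Q : G → Set X, (∀ g, MeasurableSet[F] (Q g)) ∧
    (Pairwise fun g g' => Disjoint (Q g) (Q g')) ∧
    (⋃ g, Q g) = Set.univ ∧
    ∀ g : G, ∀ x ∈ Q g, T x = g • x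

/-- `σ_G(C)`: the smallest `G`-invariant sub-σ-algebra containing the collection `C`. -/
def sigmaG (G : Type*) {X : Type*} [Group G] [MulAction G X]
    (C : Set (Set X)) : MeasurableSpace X :=
  MeasurableSpace.generateFrom {s | ∃ (g : G) (t : Set X), t ∈ C ∧ s = (fun x => g • x) ⁻¹' t}

/-- The image under an expressible bijection of a set is measurable for any σ-algebra containing
all translates of the set and all translates of `F`-measurable sets. -/
theorem Expressible.measurableSet_image {G X : Type*} [Group G] [Countable G] [MulAction G X]
    {F m : MeasurableSpace X} {T : X ≃ X} (hT : Expressible G F T)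
    (hF : ∀ (g : G) (s : Set X), MeasurableSet[F] s →
      MeasurableSet[m] ((fun x : X => g • x) ⁻¹' s))
    {A : Set X} (hA : ∀ g : G, MeasurableSet[m] ((fun x : X => g • x) ⁻¹' A)) :
    MeasurableSet[m] (T '' A) := by
  obtain ⟨Q, hQ, -, hcover, hTQ⟩ := hT
  have himage : T '' A =
      ⋃ g : G, ((fun x : X => g⁻¹ • x) ⁻¹' A) ∩ ((fun x : X => g⁻¹ • x) ⁻¹' Q g) := by
    ext y
    simp only [Set.mem_image, Set.mem_iUnion, Set.mem_inter_iff, Set.mem_preimage]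
    constructor
    · rintro ⟨x, hx, rfl⟩
      obtain ⟨g, hg⟩ := Set.mem_iUnion.1 (hcover ▸ Set.mem_univ x)
      refine ⟨g, ?_⟩
      rw [hTQ g x hg, inv_smul_smul]
      exact ⟨hx, hg⟩
    · rintro ⟨g, hyA, hyQ⟩
      exact ⟨g⁻¹ • y, hyA, by rw [hTQ g _ hyQ, smul_inv_smul]⟩
  rw [himage]
  exact MeasurableSet.iUnion fun g => (hA g⁻¹).inter (hF g⁻¹ _ (hQ g))

/-- If `T ∈ [E_G^X]` is `F`-expressible, then `T(A) ∈ σ_G({A}) ∨ F` for every Borel set `A`;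
in particular every `G`-invariant sub-σ-algebra containing `F` is `T`-invariant. -/
theorem expressible_image_mem
    {G X : Type*} [Group G] [Countable G]
    (F : MeasurableSpace X) [mX : MeasurableSpace X] [StandardBorelSpace X]
    [MulAction G X]
    (hFle : F ≤ mX)
    (hFinv : ∀ (g : G) (s : Set X), MeasurableSet[F] s →
      MeasurableSet[F] ((fun x : X => g • x) ⁻¹' s))
    (T : X ≃ X) (hT : InFullGroup G T) (hTexp : Expressible G F T) :
    (∀ A : Set X, MeasurableSet A → MeasurableSet[sigmaG G {A} ⊔ F] (T '' A)) ∧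
      (∀ m : MeasurableSpace X, m ≤ mX →
        (∀ (g : G) (s : Set X), MeasurableSet[m] s →
          MeasurableSet[m] ((fun x : X => g • x) ⁻¹' s)) →
        F ≤ m →
        ∀ s : Set X, MeasurableSet[m] s → MeasurableSet[m] (T '' s)) := by
  refine ⟨fun A _ => hTexp.measurableSet_image ?_ ?_, fun m _ hm hFm s hs => ?_⟩
  · exact fun g s hs => (le_sup_right : F ≤ sigmaG G {A} ⊔ F) _ (hFinv g s hs)
  · exact fun g => (le_sup_left : sigmaG G {A} ≤ sigmaG G {A} ⊔ F) _
      (MeasurableSpace.measurableSet_generateFrom ⟨g, A, rfl, rfl⟩)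
  · exact hTexp.measurableSet_image (fun g t ht => hm g t (hFm t ht)) fun g => hm g s hs
end

section
/- Let E be an aperiodic countable Borel equivalence relation on a standard Borel space X. Then there is a Borel function f : X → ℕ such that for every x ∈ X and every i ∈ ℕ, the set [x]_E ∩ f⁻¹(i) is infinite. -/
open MeasureTheory

/-- `E` is a countable Borel equivalence relation on `X`: a Borel subset of `X × X` which is
an equivalence relation all of whose classes are countable. -/
def IsCtblBorelEqvRel {X : Type*} [MeasurableSpace X] (E : Set (X × X)) : Prop :=
  MeasurableSet E ∧ Equivalence (fun x y : X => (x, y) ∈ E) ∧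
    ∀ x : X, {y | (x, y) ∈ E}.Countable

open Set Function Filter Topology

/-- Novikov's separation theorem for finite families of analytic sets. -/
theorem exists_measurable_superset_iInter_eq_empty {X ι : Type*} [TopologicalSpace X]
    [PolishSpace X] [MeasurableSpace X] [BorelSpace X] [Finite ι] (D : ι → Set X)
    (hD : ∀ i, AnalyticSet (D i)) (h : ⋂ i, D i = ∅) :
    ∃ G : ι → Set X, (∀ i, MeasurableSet (G i)) ∧ (∀ i, D i ⊆ G i) ∧ ⋂ i, G i = ∅ := by
  classical
  have : Fintype ι := Fintype.ofFinite ι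
  suffices H : ∀ s : Finset ι, ∃ G : ι → Set X, (∀ i, AnalyticSet (G i)) ∧
      (∀ i ∈ s, MeasurableSet (G i)) ∧ (∀ i, D i ⊆ G i) ∧ ⋂ i, G i = ∅ by
    obtain ⟨G, -, hG, hDG, hG0⟩ := H Finset.univ
    exact ⟨G, fun i => hG i (Finset.mem_univ i), hDG, hG0⟩
  intro s
  induction s using Finset.induction_on with
  | empty => exact ⟨D, hD, by simp, fun _ => Subset.rfl, h⟩
  | insert a s _ ih =>
    obtain ⟨G, hGa, hGs, hDG, hG0⟩ := ih
    have : Nonempty ι := ⟨a⟩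
    have hrest : AnalyticSet (⋂ i, if i = a then univ else G i) := by
      refine AnalyticSet.iInter fun i => ?_
      split_ifs
      · exact MeasurableSet.univ.analyticSet
      · exact hGa i
    have hdisj : Disjoint (G a) (⋂ i, if i = a then univ else G i) := by
      rw [Set.disjoint_left]
      intro x hxa hx
      have : x ∈ ⋂ i, G i := by
        rw [mem_iInter] at hx ⊢
        intro i
        by_cases hi : i = a
        · rwa [hi]
        · simpa [hi] using hx i
      simp [hG0] at this
    obtain ⟨u, hGu, hu, hum⟩ := (hGa a).measurablySeparable hrest hdisj
    refine ⟨update G a u, fun i => ?_, fun i hi => ?_, fun i => ?_, ?_⟩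
    · by_cases hi : i = a
      · subst hi; simpa using hum.analyticSet
      · simpa [hi] using hGa i
    · by_cases hia : i = a
      · subst hia; simpa using hum
      · simpa [hia] using hGs i (by simpa [hia] using hi)
    · by_cases hi : i = a
      · subst hi; simpa using (hDG i).trans hGu
      · simpa [hi] using hDG i
    · rw [eq_empty_iff_forall_notMem]
      intro x hx
      rw [mem_iInter] at hx
      refine Set.disjoint_left.1 hu ?_ (by simpa using hx a)
      rw [mem_iInter]
      intro i
      by_cases hi : i = a
      · simp [hi]
      · simpa [hi] using hx i

/-- `Z` is a countable union of measurable sets on each of which `π` is injective. -/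
def IsSigmaInjOn {P X : Type*} [MeasurableSpace P] (π : P → X) (Z : Set P) : Prop :=
  ∃ B : ℕ → Set P, (∀ n, MeasurableSet (B n)) ∧ (∀ n, InjOn π (B n)) ∧ Z = ⋃ n, B n

namespace IsSigmaInjOn

variable {P X : Type*} [MeasurableSpace P] {π : P → X}

theorem measurableSet {Z : Set P} (h : IsSigmaInjOn π Z) : MeasurableSet Z := by
  obtain ⟨B, hB, -, rfl⟩ := h
  exact MeasurableSet.iUnion hB

theorem of_injOn {Z : Set P} (hZ : MeasurableSet Z) (h : InjOn π Z) : IsSigmaInjOn π Z :=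
  ⟨fun _ => Z, fun _ => hZ, fun _ => h, (iUnion_const Z).symm⟩

theorem iUnion {ι : Type*} [Countable ι] {Z : ι → Set P} (h : ∀ i, IsSigmaInjOn π (Z i)) :
    IsSigmaInjOn π (⋃ i, Z i) := by
  choose B hB hinj hZ using h
  rcases isEmpty_or_nonempty ι with _ | _
  · simpa using of_injOn (π := π) MeasurableSet.empty (injOn_empty π)
  obtain ⟨e, he⟩ := exists_surjective_nat (ι × ℕ)
  refine ⟨fun n => B (e n).1 (e n).2, fun n => hB _ _, fun n => hinj _ _, ?_⟩
  rw [he.iUnion_comp (fun p : ι × ℕ => B p.1 p.2), iUnion_prod']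
  exact iUnion_congr hZ

theorem union {Z Z' : Set P} (h : IsSigmaInjOn π Z) (h' : IsSigmaInjOn π Z') :
    IsSigmaInjOn π (Z ∪ Z') := by
  rw [union_eq_iUnion]
  exact iUnion fun b => by cases b <;> assumption

end IsSigmaInjOn

/-- The family `U` is thin if, up to a set which is `σ`-injective for `π`, every fibre of `π`
misses some member of `U`. -/
def IsThin {P X ι : Type*} [MeasurableSpace P] (π : P → X) (U : ι → Set P) : Prop :=
  ∃ Z, IsSigmaInjOn π Z ∧ ∀ x, ∃ i, ∀ p ∈ U i, π p = x → p ∈ Z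

theorem exists_mem_countableBasis_closure_subset {P : Type*} [MetricSpace P]
    [SecondCountableTopology P] {U : Set P} (hU : IsOpen U) {p : P} (hp : p ∈ U) {r : ℝ}
    (hr : 0 < r) :
    ∃ v ∈ TopologicalSpace.countableBasis P,
      p ∈ v ∧ closure v ⊆ U ∧ v ⊆ Metric.ball p r := by
  obtain ⟨ε, hε, hεU⟩ := Metric.nhds_basis_closedBall.mem_iff.1 (hU.mem_nhds hp)
  obtain ⟨v, hv, hpv, hvs⟩ := (TopologicalSpace.isBasis_countableBasis P).exists_subset_of_mem_open
    (Metric.mem_ball_self (x := p) (lt_min hε hr)) Metric.isOpen_ball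
  refine ⟨v, hv, hpv, ?_, hvs.trans (Metric.ball_subset_ball (min_le_right _ _))⟩
  exact (closure_mono (hvs.trans (Metric.ball_subset_ball (min_le_left _ _)))).trans
    (Metric.closure_ball_subset_closedBall.trans hεU)

/-- Every member of a finite non-thin family of open sets can be split into two small
disjoint open sets so that the resulting family is still not thin. -/
theorem exists_split_of_not_isThin {P X ι : Type*} [Finite ι] [MetricSpace P] [CompleteSpace P]
    [SecondCountableTopology P] [MeasurableSpace P] [BorelSpace P] [TopologicalSpace X]
    [PolishSpace X] [MeasurableSpace X] [BorelSpace X] {π : P → X} (hπ : Measurable π)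
    {U : ι → Set P} (hU : ∀ i, IsOpen (U i)) (hthin : ¬ IsThin π U) {ε : ℝ} (hε : 0 < ε) :
    ∃ V : ι → Bool → Set P, (∀ i b, IsOpen (V i b)) ∧ (∀ i b, closure (V i b) ⊆ U i) ∧
      (∀ i b, ∀ p ∈ V i b, ∀ q ∈ V i b, dist p q ≤ ε) ∧
      (∀ i, Disjoint (V i false) (V i true)) ∧ ¬ IsThin π (fun j : ι × Bool => V j.1 j.2) := by
  by_contra! hcon
  let T := {V : ι → Bool → TopologicalSpace.countableBasis P //
    (∀ i b, closure (V i b : Set P) ⊆ U i) ∧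
    (∀ i b, ∀ p ∈ (V i b : Set P), ∀ q ∈ (V i b : Set P), dist p q ≤ ε) ∧
    (∀ i, Disjoint (V i false : Set P) (V i true))}
  have hT : ∀ V : T, ∃ Z, IsSigmaInjOn π Z ∧
      ∀ x, ∃ j : ι × Bool, ∀ p ∈ (V.1 j.1 j.2 : Set P), π p = x → p ∈ Z := fun V =>
    hcon (fun i b => V.1 i b)
      (fun i b => (TopologicalSpace.isBasis_countableBasis P).isOpen (V.1 i b).2)
      V.2.1 V.2.2.1 V.2.2.2
  choose Z hZ hZV using hT
  have : Countable (TopologicalSpace.countableBasis P) :=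
    (TopologicalSpace.countable_countableBasis P).to_subtype
  have hZ' : IsSigmaInjOn π (⋃ V, Z V) := IsSigmaInjOn.iUnion hZ
  set Z' := ⋃ V, Z V with hZ'def
  let A : ι → Set P := fun i => U i \ Z'
  have hA : ∀ i, MeasurableSet (A i) := fun i => (hU i).measurableSet.diff hZ'.measurableSet
  let R : ι → Set (P × P) := fun i =>
    {w | w.1 ∈ A i ∧ w.2 ∈ A i ∧ w.1 ≠ w.2 ∧ π w.1 = π w.2}
  have hR : ∀ i, MeasurableSet (R i) := fun i =>
    (measurable_fst (hA i)).inter ((measurable_snd (hA i)).inter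
      ((measurableSet_eq_fun measurable_fst measurable_snd).compl.inter
        (measurableSet_eq_fun (hπ.comp measurable_fst) (hπ.comp measurable_snd))))
  obtain ⟨G, hG, hDG, hG0⟩ := exists_measurable_superset_iInter_eq_empty
    (fun i => (fun w : P × P => π w.1) '' R i)
    (fun i => (hR i).analyticSet_image (hπ.comp measurable_fst)) (by
      rw [eq_empty_iff_forall_notMem]
      intro x hx
      rw [mem_iInter] at hx
      choose w hw hwx using hx
      have key : ∀ i, ∃ v : Bool → TopologicalSpace.countableBasis P,
          (∀ b, closure (v b : Set P) ⊆ U i) ∧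
          (∀ b, ∀ p ∈ (v b : Set P), ∀ q ∈ (v b : Set P), dist p q ≤ ε) ∧
          Disjoint (v false : Set P) (v true) ∧
          (w i).1 ∈ (v false : Set P) ∧ (w i).2 ∈ (v true : Set P) := by
        intro i
        have hd : 0 < dist (w i).1 (w i).2 := dist_pos.2 (hw i).2.2.1
        have hr : 0 < min (ε / 2) (dist (w i).1 (w i).2 / 2) := by positivity
        obtain ⟨v₁, hv₁, hp₁, hc₁, hb₁⟩ :=
          exists_mem_countableBasis_closure_subset (hU i) (hw i).1.1 hr
        obtain ⟨v₂, hv₂, hp₂, hc₂, hb₂⟩ :=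
          exists_mem_countableBasis_closure_subset (hU i) (hw i).2.1.1 hr
        have hdiam : ∀ c : P, ∀ p ∈ Metric.ball c (min (ε / 2) (dist (w i).1 (w i).2 / 2)),
            ∀ q ∈ Metric.ball c (min (ε / 2) (dist (w i).1 (w i).2 / 2)), dist p q ≤ ε := by
          intro c p hp q hq
          rw [Metric.mem_ball] at hp hq
          have h1 := hp.trans_le (min_le_left _ _)
          have h2 := hq.trans_le (min_le_left _ _)
          linarith [dist_triangle_right p q c]
        refine ⟨fun b => bif b then ⟨v₂, hv₂⟩ else ⟨v₁, hv₁⟩, ?_, ?_, ?_, hp₁, hp₂⟩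
        · rintro (_ | _) <;> assumption
        · rintro (_ | _) p hp q hq
          · exact hdiam _ p (hb₁ hp) q (hb₁ hq)
          · exact hdiam _ p (hb₂ hp) q (hb₂ hq)
        · refine Disjoint.mono hb₁ hb₂ (Metric.ball_disjoint_ball ?_)
          linarith [min_le_right (ε / 2) (dist (w i).1 (w i).2 / 2)]
      choose v hvc hvd hvdisj hv1 hv2 using key
      let V : T := ⟨v, hvc, hvd, hvdisj⟩
      obtain ⟨⟨i, b⟩, hb⟩ := hZV V x
      cases b
      · exact (hw i).1.2 (mem_iUnion.2 ⟨V, hb _ (hv1 i) (hwx i)⟩)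
      · exact (hw i).2.1.2 (mem_iUnion.2 ⟨V, hb _ (hv2 i) ((hw i).2.2.2.symm.trans (hwx i))⟩))
  refine hthin ⟨Z' ∪ ⋃ i, A i \ π ⁻¹' G i, hZ'.union (IsSigmaInjOn.iUnion fun i =>
    IsSigmaInjOn.of_injOn ((hA i).diff (hπ (hG i))) ?_), fun x => ?_⟩
  · intro p hp q hq hpq
    by_contra hne
    exact hp.2 (hDG i ⟨(p, q), ⟨hp.1, hq.1, hne, hpq⟩, rfl⟩)
  · have hx : x ∉ ⋂ i, G i := by simp [hG0]
    rw [mem_iInter, not_forall] at hx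
    obtain ⟨i, hi⟩ := hx
    refine ⟨i, fun p hp hpx => ?_⟩
    by_cases hpZ : p ∈ Z'
    · exact Or.inl hpZ
    · exact Or.inr (mem_iUnion.2 ⟨i, ⟨hp, hpZ⟩, by simpa [hpx] using hi⟩)

/-- A continuous map between Polish spaces whose domain is not `σ`-injective has an uncountable
fibre. -/
theorem exists_not_countable_fibre_of_not_isSigmaInjOn {P X : Type*} [MetricSpace P]
    [CompleteSpace P] [SecondCountableTopology P] [MeasurableSpace P] [BorelSpace P]
    [TopologicalSpace X] [PolishSpace X] [MeasurableSpace X] [BorelSpace X] {π : P → X}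
    (hπ : Continuous π) (h : ¬ IsSigmaInjOn π univ) : ∃ x, ¬ (π ⁻¹' {x}).Countable := by
  let Φ : ℕ → (List Bool → Set P) → Prop := fun n U =>
    (∀ l, IsOpen (U l)) ∧ ¬ IsThin π (fun l : List.Vector Bool n => U l.1)
  have step : ∀ n U, Φ n U → ∃ V, Φ (n + 1) V ∧ ∀ l : List Bool, l.length = n →
      (∀ b, closure (V (b :: l)) ⊆ U l) ∧
      (∀ b, ∀ p ∈ V (b :: l), ∀ q ∈ V (b :: l), dist p q ≤ 1 / ((n : ℝ) + 1)) ∧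
      Disjoint (V (false :: l)) (V (true :: l)) := by
    rintro n U ⟨hU, hUthin⟩
    obtain ⟨V, hVo, hVc, hVd, hVdisj, hVthin⟩ := exists_split_of_not_isThin hπ.measurable
      (fun l : List.Vector Bool n => hU l.1) hUthin (ε := 1 / ((n : ℝ) + 1)) (by positivity)
    let W : List Bool → Set P := fun
      | [] => univ
      | b :: l => if hl : l.length = n then V ⟨l, hl⟩ b else univ
    have hW : ∀ l (hl : l.length = n) b, W (b :: l) = V ⟨l, hl⟩ b := fun l hl b => dif_pos hl
    refine ⟨W, ⟨?_, ?_⟩, fun l hl => ?_⟩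
    · rintro (_ | ⟨b, l⟩)
      · exact isOpen_univ
      · by_cases hl : l.length = n
        · rw [hW l hl]; exact hVo _ _
        · simp [W, hl]
    · rintro ⟨Z, hZ, hZW⟩
      refine hVthin ⟨Z, hZ, fun x => ?_⟩
      obtain ⟨⟨l, hl⟩, hlZ⟩ := hZW x
      cases l with
      | nil => simp at hl
      | cons b l =>
        have hl' : l.length = n := by simpa using hl
        refine ⟨(⟨l, hl'⟩, b), fun p hp => hlZ p ?_⟩
        change p ∈ W (b :: l)
        rwa [hW l hl']
    · simp only [hW l hl]
      exact ⟨hVc _, hVd _, hVdisj _⟩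
  choose! V hV hVl using step
  have h0 : Φ 0 (fun _ => univ) := by
    refine ⟨fun _ => isOpen_univ, ?_⟩
    rintro ⟨Z, hZ, hZU⟩
    have : Z = univ := eq_univ_of_forall fun p => by
      obtain ⟨i, hi⟩ := hZU (π p)
      exact hi p (mem_univ p) rfl
    exact h (this ▸ hZ)
  let S : ℕ → List Bool → Set P := fun n => Nat.rec (fun _ => univ) V n
  have hS : ∀ n, Φ n (S n) := fun n => by
    induction n with
    | zero => exact h0
    | succ n ih => exact hV n _ ih
  let A : List Bool → Set P := fun l => S l.length l
  have hA : ∀ l : List Bool, (∀ b, closure (A (b :: l)) ⊆ A l) ∧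
      (∀ b, ∀ p ∈ A (b :: l), ∀ q ∈ A (b :: l), dist p q ≤ 1 / ((l.length : ℝ) + 1)) ∧
      Disjoint (A (false :: l)) (A (true :: l)) := fun l => hVl l.length _ (hS _) l rfl
  have hne : ∀ n, ∃ x, ∀ l : List Bool, l.length = n → ∃ p ∈ A l, π p = x := by
    intro n
    by_contra! hcon
    refine (hS n).2 ⟨∅, IsSigmaInjOn.of_injOn MeasurableSet.empty (injOn_empty π), fun x => ?_⟩
    obtain ⟨l, hl, hlx⟩ := hcon x
    refine ⟨⟨l, hl⟩, fun p hp hpx => hlx p ?_ hpx⟩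
    subst hl
    exact hp
  choose x hx using hne
  have hanti : CantorScheme.ClosureAntitone A := fun l => (hA l).1
  have hdisj : CantorScheme.Disjoint A := by
    rintro l (_ | _) (_ | _) hab
    · exact absurd rfl hab
    · exact (hA l).2.2
    · exact (hA l).2.2.symm
    · exact absurd rfl hab
  have hdist : ∀ (a : ℕ → Bool) (n : ℕ), ∀ p ∈ A (PiNat.res a (n + 1)),
      ∀ q ∈ A (PiNat.res a (n + 1)), dist p q ≤ 1 / ((n : ℝ) + 1) := fun a n => by
    simpa using (hA (PiNat.res a n)).2.1 (a n)
  have hdiam : CantorScheme.VanishingDiam A := by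
    intro a
    rw [← tendsto_add_atTop_iff_nat 1]
    have hlim : Tendsto (fun n : ℕ => ENNReal.ofReal (1 / ((n : ℝ) + 1))) atTop (𝓝 0) := by
      simpa using ENNReal.tendsto_ofReal tendsto_one_div_add_atTop_nhds_zero_nat
    exact tendsto_of_tendsto_of_tendsto_of_le_of_le tendsto_const_nhds hlim
      (fun _ => zero_le) fun n => Metric.ediam_le_of_forall_dist_le (hdist a n)
  have hnonempty : ∀ l, (A l).Nonempty := fun l =>
    let ⟨p, hp, _⟩ := hx l.length l rfl
    ⟨p, hp⟩
  have htotal := hanti.map_of_vanishingDiam hdiam hnonempty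
  have hmem : ∀ a, a ∈ (CantorScheme.inducedMap A).1 := fun a => htotal ▸ mem_univ a
  let φ : (ℕ → Bool) → P := fun a => (CantorScheme.inducedMap A).2 ⟨a, hmem a⟩
  have hφ : Injective φ := fun a b hab => congrArg Subtype.val (hdisj.map_injective hab)
  have hφA : ∀ a n, φ a ∈ A (PiNat.res a n) := fun a n => CantorScheme.map_mem _ n
  have hlim : ∀ a, Tendsto x atTop (𝓝 (π (φ a))) := by
    intro a
    choose p hp hpx using fun n => hx n (PiNat.res a n) (PiNat.res_length a n)
    have hpφ : Tendsto p atTop (𝓝 (φ a)) := by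
      rw [← tendsto_add_atTop_iff_nat 1, tendsto_iff_dist_tendsto_zero]
      exact squeeze_zero (fun _ => dist_nonneg) (fun n => hdist a n _ (hp (n + 1)) _ (hφA a (n + 1)))
        tendsto_one_div_add_atTop_nhds_zero_nat
    simpa only [Function.comp_def, hpx] using (hπ.tendsto (φ a)).comp hpφ
  refine ⟨π (φ fun _ => false), fun hcount => ?_⟩
  have huniv : (univ : Set (ℕ → Bool)).Countable :=
    MapsTo.countable_of_injOn (f := φ) (t := π ⁻¹' {π (φ fun _ => false)})
      (fun a _ => tendsto_nhds_unique (hlim a) (hlim fun _ => false)) hφ.injOn hcount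
  rw [countable_univ_iff, ← Cardinal.mk_le_aleph0_iff] at huniv
  simp at huniv
  exact absurd huniv Cardinal.aleph0_lt_continuum.not_ge

/-- **Lusin–Novikov theorem**: if a measurable map between standard Borel spaces has countable
fibres, then its domain is a countable union of measurable sets on which the map is injective. -/
theorem isSigmaInjOn_univ_of_countable_fibres {P X : Type*} [MeasurableSpace P]
    [StandardBorelSpace P] [MeasurableSpace X] [StandardBorelSpace X] {π : P → X}
    (hπ : Measurable π) (hc : ∀ x, (π ⁻¹' {x}).Countable) : IsSigmaInjOn π univ := by
  let := upgradeStandardBorel X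
  obtain ⟨t, ht, htp⟩ := StandardBorelSpace.polish (α := P)
  obtain ⟨t', ht't, hcont, htp'⟩ := hπ.exists_continuous
  have hb : @BorelSpace P t' _ := by
    constructor
    rw [@BorelSpace.measurable_eq P t _ ht]
    exact (MeasureTheory.borel_eq_borel_of_le htp' htp ht't).symm
  clear ht't ht htp t
  let := TopologicalSpace.upgradeIsCompletelyMetrizable P
  by_contra h
  obtain ⟨x, hx⟩ := exists_not_countable_fibre_of_not_isSigmaInjOn hcont h
  exact hx (hc x)

/-- A countable Borel equivalence relation is enumerated by countably many Borel functions. -/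
theorem IsCtblBorelEqvRel.exists_measurable_seq {X : Type*} [MeasurableSpace X]
    [StandardBorelSpace X] {E : Set (X × X)} (hE : IsCtblBorelEqvRel E) :
    ∃ g : ℕ → X → X, (∀ n, Measurable (g n)) ∧ ∀ x y, (x, y) ∈ E ↔ ∃ n, g n x = y := by
  classical
  obtain ⟨hEm, hEe, hEc⟩ := hE
  have : StandardBorelSpace E := hEm.standardBorel
  have hfst : Measurable fun p : E => p.1.1 := measurable_fst.comp measurable_subtype_coe
  have hsnd : Measurable fun p : E => p.1.2 := measurable_snd.comp measurable_subtype_coe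
  obtain ⟨B, hB, hinj, hBu⟩ := isSigmaInjOn_univ_of_countable_fibres hfst (fun x =>
    MapsTo.countable_of_injOn (f := fun p : E => p.1.2) (t := {y | (x, y) ∈ E})
      (by rintro ⟨⟨a, b⟩, hab⟩ rfl; exact hab)
      (by
        rintro ⟨⟨a, b⟩, hab⟩ rfl ⟨⟨a', b'⟩, hab'⟩ rfl h
        simpa using h) (hEc x))
  let g : ℕ → X → X := fun n x => if h : ∃ p ∈ B n, p.1.1 = x then h.choose.1.2 else x
  have hg : ∀ n, ∀ p ∈ B n, g n p.1.1 = p.1.2 := by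
    intro n p hp
    have h : ∃ q ∈ B n, q.1.1 = p.1.1 := ⟨p, hp, rfl⟩
    have : h.choose = p := hinj n h.choose_spec.1 hp h.choose_spec.2
    simp only [g, dif_pos h, this]
  have hg' : ∀ n x, (¬ ∃ p ∈ B n, p.1.1 = x) → g n x = x := fun n x h => dif_neg h
  refine ⟨g, fun n s hs => ?_, fun x y => ⟨fun h => ?_, ?_⟩⟩
  · have himg : ∀ t, MeasurableSet t → MeasurableSet ((fun p : E => p.1.1) '' (B n ∩ t)) :=
      fun t ht => ((hB n).inter ht).image_of_measurable_injOn hfst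
        ((hinj n).mono inter_subset_left)
    have : g n ⁻¹' s = (fun p : E => p.1.1) '' (B n ∩ (fun p : E => p.1.2) ⁻¹' s) ∪
        (s \ (fun p : E => p.1.1) '' (B n ∩ univ)) := by
      ext x
      by_cases h : ∃ p ∈ B n, p.1.1 = x
      · obtain ⟨p, hp, rfl⟩ := h
        rw [mem_preimage, hg n p hp]
        constructor
        · exact fun hps => Or.inl ⟨p, ⟨hp, hps⟩, rfl⟩
        · rintro (⟨q, ⟨hq, hqs⟩, hqp⟩ | ⟨-, h⟩)
          · rwa [← hinj n hq hp hqp]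
          · exact absurd ⟨p, ⟨hp, mem_univ _⟩, rfl⟩ h
      · rw [mem_preimage, hg' n x h]
        constructor
        · exact fun hx => Or.inr ⟨hx, fun ⟨p, hp, hpx⟩ => h ⟨p, hp.1, hpx⟩⟩
        · rintro (⟨q, ⟨hq, -⟩, hqx⟩ | ⟨hx, -⟩)
          · exact absurd ⟨q, hq, hqx⟩ h
          · exact hx
    rw [this]
    exact (himg _ (hsnd hs)).union (hs.diff (himg _ MeasurableSet.univ))
  · have hp : (⟨(x, y), h⟩ : E) ∈ ⋃ n, B n := hBu ▸ mem_univ _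
    obtain ⟨n, hn⟩ := mem_iUnion.1 hp
    exact ⟨n, hg n _ hn⟩
  · rintro ⟨n, rfl⟩
    by_cases h : ∃ p ∈ B n, p.1.1 = x
    · obtain ⟨p, hp, rfl⟩ := h
      rw [hg n p hp]
      exact p.2
    · rw [hg' n x h]
      exact hEe.refl x

/-- The set of points whose class, enumerated by measurable functions, meets a given measurable
set in an infinite set is measurable. -/
theorem measurableSet_infinite_range_inter {X : Type*} [MeasurableSpace X] [StandardBorelSpace X]
    {g : ℕ → X → X} (hg : ∀ n, Measurable (g n)) {A : Set X} (hA : MeasurableSet A) :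
    MeasurableSet {x | (range (fun n => g n x) ∩ A).Infinite} := by
  have h : {x | (range (fun n => g n x) ∩ A).Infinite} =
      (⋃ N : ℕ, ⋂ n : ℕ, (g n ⁻¹' A)ᶜ ∪ ⋃ m ∈ Iio N, {x | g n x = g m x})ᶜ := by
    ext x
    rw [mem_compl_iff, mem_ofPred_eq, Set.Infinite, not_iff_not]
    simp only [mem_iUnion, mem_iInter, mem_union, mem_compl_iff, mem_preimage, mem_ofPred_eq,
      mem_Iio, exists_prop]
    constructor
    · intro hfin
      choose! k hk using fun y (hy : y ∈ range (fun n => g n x) ∩ A) => hy.1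
      obtain ⟨N, hN⟩ := (hfin.image k).bddAbove
      refine ⟨N + 1, fun n => or_iff_not_imp_left.2 fun hn => ?_⟩
      have hmem : g n x ∈ range (fun n => g n x) ∩ A := ⟨⟨n, rfl⟩, not_not.1 hn⟩
      exact ⟨k (g n x), Nat.lt_succ_of_le (hN ⟨_, hmem, rfl⟩), (hk _ hmem).symm⟩
    · rintro ⟨N, hN⟩
      refine ((finite_Iio N).image fun m => g m x).subset ?_
      rintro y ⟨⟨n, rfl⟩, hn⟩
      rcases hN n with h | ⟨m, hm, hnm⟩
      · exact absurd hn h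
      · exact ⟨m, hm, hnm.symm⟩
  rw [h]
  exact (MeasurableSet.iUnion fun N => MeasurableSet.iInter fun n =>
    (hg n hA).compl.union (MeasurableSet.biUnion (to_countable _) fun m _ =>
      measurableSet_eq_fun (hg n) (hg m))).compl

/-- Vanishing markers: an aperiodic countable Borel equivalence relation admits a decreasing
sequence of Borel sets, each meeting every class in an infinite set, whose intersection meets every
class in at most one point. -/
theorem IsCtblBorelEqvRel.exists_markers {X : Type*} [MeasurableSpace X]
    [StandardBorelSpace X] {E : Set (X × X)} (hE : IsCtblBorelEqvRel E)
    (haper : ∀ x : X, {y | (x, y) ∈ E}.Infinite) :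
    ∃ A : ℕ → Set X, A 0 = univ ∧ Antitone A ∧ (∀ n, MeasurableSet (A n)) ∧
      (∀ n x, ({y | (x, y) ∈ E} ∩ A n).Infinite) ∧
      ∀ x y, (x, y) ∈ E → (∀ n, x ∈ A n) → (∀ n, y ∈ A n) → x = y := by
  obtain ⟨g, hg, hgE⟩ := hE.exists_measurable_seq
  obtain ⟨-, hEe, -⟩ := hE
  obtain ⟨S, hS, hsep⟩ := exists_seq_separating X MeasurableSet.univ univ
  have hclass : ∀ x, {y | (x, y) ∈ E} = range fun n => g n x := fun x => by
    ext y; exact hgE x y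
  have hcongr : ∀ x y, (x, y) ∈ E → {z | (x, z) ∈ E} = {z | (y, z) ∈ E} := fun x y hxy => by
    ext z; exact ⟨hEe.trans (hEe.symm hxy), hEe.trans hxy⟩
  let next : ℕ → Set X → Set X := fun n A =>
    {x | x ∈ A ∧ (x ∈ S n ↔ ({y | (x, y) ∈ E} ∩ (A ∩ S n)).Infinite)}
  let A : ℕ → Set X := fun n => Nat.rec univ next n
  have hsucc : ∀ n, A (n + 1) = next n (A n) := fun _ => rfl
  refine ⟨A, rfl, antitone_nat_of_succ_le fun n x hx => hx.1, fun n => ?_, fun n => ?_, ?_⟩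
  · induction n with
    | zero => exact MeasurableSet.univ
    | succ n ih =>
      have h := measurableSet_infinite_range_inter hg (ih.inter (hS n))
      simp only [← hclass] at h
      exact ih.inter (MeasurableSet.iff (hS n) h)
  · induction n with
    | zero => simpa [A] using haper
    | succ n ih =>
      intro x
      by_cases hinf : ({y | (x, y) ∈ E} ∩ (A n ∩ S n)).Infinite
      · refine hinf.mono ?_
        rintro y ⟨hxy, hyA, hyS⟩
        refine ⟨hxy, hyA, iff_of_true hyS ?_⟩
        rwa [← hcongr x y hxy]
      · have hfin := not_infinite.1 hinf
        refine ((ih x).sdiff hfin).mono ?_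
        rintro y ⟨⟨hxy, hyA⟩, hy⟩
        refine ⟨hxy, hyA, iff_of_false (fun hyS => hy ⟨hxy, hyA, hyS⟩) ?_⟩
        rwa [← hcongr x y hxy]
  · intro x y hxy hx hy
    refine hsep x (mem_univ x) y (mem_univ y) fun n => ?_
    rw [(hx (n + 1)).2, (hy (n + 1)).2, hcongr x y hxy]

/-- For every aperiodic countable Borel equivalence relation `E` on a standard Borel space,
there is a Borel function `f : X → ℕ` such that every `E`-class meets every level set `f⁻¹(i)`
in an infinite set. -/
theorem exists_borel_function_infinite_in_classes
    {X : Type*} [MeasurableSpace X] [StandardBorelSpace X]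
    (E : Set (X × X)) (hE : IsCtblBorelEqvRel E)
    (haper : ∀ x : X, {y | (x, y) ∈ E}.Infinite) :
    ∃ f : X → ℕ, Measurable f ∧
      ∀ (x : X) (i : ℕ), ({y | (x, y) ∈ E} ∩ f ⁻¹' {i}).Infinite := by
  classical
  obtain ⟨A, hA0, hanti, hAm, hAinf, hAinter⟩ := hE.exists_markers haper
  obtain ⟨g, hg, hgE⟩ := hE.exists_measurable_seq
  obtain ⟨-, hEe, -⟩ := hE
  let D : ℕ → Set X := fun n => A n \ A (n + 1)
  have hD : ∀ n, MeasurableSet (D n) := fun n => (hAm n).diff (hAm (n + 1))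
  have hDdisj : ∀ {m n x}, x ∈ D m → x ∈ D n → m = n := by
    intro m n x hm hn
    by_contra hne
    rcases Nat.lt_or_gt_of_ne hne with h | h
    · exact hm.2 (hanti h hn.1)
    · exact hn.2 (hanti h hm.1)
  have hDex : ∀ n x, x ∈ A n → (¬ ∀ m, x ∈ A m) → ∃ m, n ≤ m ∧ x ∈ D m := by
    intro n x hxn hx
    have hx' : ∃ m, x ∉ A m := not_forall.1 hx
    have hlt : n < Nat.find hx' := by
      by_contra hle
      exact Nat.find_spec hx' (hanti (not_lt.1 hle) hxn)
    refine ⟨Nat.find hx' - 1, by omega, ?_, ?_⟩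
    · exact not_not.1 (Nat.find_min hx' (by omega))
    · rw [Nat.sub_add_cancel (by omega)]
      exact Nat.find_spec hx'
  let N : X → ℕ → Prop := fun x n => ∃ y, (x, y) ∈ E ∧ y ∈ D n
  have hN : ∀ x, (Set.ofPred (N x)).Infinite := by
    intro x
    rw [infinite_iff_exists_gt]
    intro n
    obtain ⟨y, ⟨hxy, hyA⟩, z, ⟨hxz, hzA⟩, hyz⟩ := (hAinf (n + 1) x).nontrivial
    have : ∃ w, (x, w) ∈ E ∧ w ∈ A (n + 1) ∧ ¬ ∀ m, w ∈ A m := by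
      by_cases hy : ∀ m, y ∈ A m
      · exact ⟨z, hxz, hzA, fun hz =>
          hyz (hAinter y z (hEe.trans (hEe.symm hxy) hxz) hy hz)⟩
      · exact ⟨y, hxy, hyA, hy⟩
    obtain ⟨w, hxw, hwA, hw⟩ := this
    obtain ⟨m, hm, hwm⟩ := hDex _ w hwA hw
    exact ⟨m, ⟨w, hxw, hwm⟩, hm⟩
  have hNcongr : ∀ x y, (x, y) ∈ E → N x = N y := fun x y hxy => by
    ext n
    exact ⟨fun ⟨z, hz, hzn⟩ => ⟨z, hEe.trans (hEe.symm hxy) hz, hzn⟩,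
      fun ⟨z, hz, hzn⟩ => ⟨z, hEe.trans hxy hz, hzn⟩⟩
  have hNm : ∀ n, MeasurableSet {x | N x n} := by
    intro n
    have : {x | N x n} = ⋃ k, g k ⁻¹' D n := by
      ext x
      simp only [N, mem_ofPred_eq, mem_iUnion, mem_preimage, hgE]
      exact ⟨fun ⟨y, ⟨k, hk⟩, hy⟩ => ⟨k, hk ▸ hy⟩, fun ⟨k, hk⟩ => ⟨_, ⟨k, rfl⟩, hk⟩⟩
    rw [this]
    exact MeasurableSet.iUnion fun k => hg k (hD n)
  have hcount : ∀ n, Measurable fun x => Nat.count (N x) n := by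
    intro n
    induction n with
    | zero => simp
    | succ n ih =>
      simp only [Nat.count_succ]
      exact ih.add (Measurable.ite (hNm n) measurable_const measurable_const)
  let s : Set X := {x | ∀ m, x ∈ A m}
  have hs : MeasurableSet s := by
    have : s = ⋂ m, A m := by ext x; simp [s]
    rw [this]
    exact MeasurableSet.iInter hAm
  have hr : ∀ x, ∃ n, x ∈ s ∨ x ∈ D n := by
    intro x
    by_cases hx : ∀ m, x ∈ A m
    · exact ⟨0, Or.inl hx⟩
    · obtain ⟨m, -, hm⟩ := hDex 0 x (by simp [hA0]) hx
      exact ⟨m, Or.inr hm⟩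
  let f : X → ℕ := fun x => (Nat.unpair (Nat.count (N x) (Nat.find (hr x)))).1
  have hfD : ∀ n x, x ∈ D n → f x = (Nat.unpair (Nat.count (N x) n)).1 := by
    intro n x hx
    have : Nat.find (hr x) = n := by
      rcases Nat.find_spec (hr x) with h | h
      · exact absurd (h (n + 1)) hx.2
      · exact hDdisj h hx
    simp only [f, this]
  refine ⟨f, ?_, fun x i hfin => ?_⟩
  · exact (measurable_from_top (f := fun n => (Nat.unpair n).1)).comp
      (Measurable.find (f := fun n x => Nat.count (N x) n)
        (p := fun n x => x ∈ s ∨ x ∈ D n) hcount (fun n => hs.union (hD n)) hr)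
  · let c : ℕ → ℕ := fun k => Nat.nth (N x) (Nat.pair i k)
    have hc : Injective c := fun k l hkl =>
      (Nat.pair_eq_pair.1 (Nat.nth_injective (hN x) hkl)).2
    choose y hxy hyD using fun k => Nat.nth_mem_of_infinite (hN x) (Nat.pair i k)
    have hy : Injective y := fun k l hkl =>
      hc (hDdisj (hyD k) (hkl ▸ hyD l))
    refine infinite_range_of_injective hy (hfin.subset ?_)
    rintro _ ⟨k, rfl⟩
    refine ⟨hxy k, ?_⟩
    rw [mem_preimage, mem_singleton_iff, hfD _ _ (hyD k), ← hNcongr x _ (hxy k),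
      Nat.count_nth_of_infinite (hN x), Nat.unpair_pair]
end

section
/- Let X be a standard Borel space, let E be an aperiodic countable Borel equivalence relation on X, and let Γ ⊆ E be a locally finite Borel graph on X. Then there is a Borel Γ-coloring f : X → ℕ such that for every x ∈ X and every i ∈ ℕ, the set [x]_E ∩ f⁻¹(i) is infinite. -/
open MeasureTheory

/-- `Γ` is a Borel graph on `X`: a symmetric irreflexive Borel subset of `X × X`. -/
def IsBorelGraph {X : Type*} [MeasurableSpace X] (Γ : Set (X × X)) : Prop :=
  MeasurableSet Γ ∧ (∀ x y : X, (x, y) ∈ Γ → (y, x) ∈ Γ) ∧ ∀ x : X, (x, x) ∉ Γ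

/-- `D` is covered by countably many Borel sets, each meeting every vertical section in at most
one point. -/
def IsGraphCovered {α β : Type*} [MeasurableSpace α] [MeasurableSpace β] (D : Set (α × β)) : Prop :=
  ∃ S : Set (Set (α × β)), S.Countable ∧ (∀ G ∈ S, MeasurableSet G ∧ G.InjOn Prod.fst) ∧ D ⊆ ⋃₀ S

/-- A finite family of measurable sets parametrizing pieces of a relation through `z ↦ (x z, y z)`
is large if no graph-covered set contains, over each point, a full section of some piece. -/
def IsLargeFamily {Ω α β : Type*} [MeasurableSpace Ω] [MeasurableSpace α] [MeasurableSpace β]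
    (x : Ω → α) (y : Ω → β) (F : Finset (Set Ω)) : Prop :=
  (∀ W ∈ F, MeasurableSet W) ∧
    ∀ D : Set (α × β), IsGraphCovered D → ∃ a, ∀ W ∈ F, ∃ z ∈ W, x z = a ∧ (a, y z) ∉ D

section BorelCombinatorics

open Set Filter Topology

lemma MeasureTheory.AnalyticSet.inter {α : Type*} [TopologicalSpace α] [T2Space α] {s t : Set α}
    (hs : AnalyticSet s) (ht : AnalyticSet t) : AnalyticSet (s ∩ t) := by
  rw [inter_eq_iInter]
  exact .iInter fun b ↦ by cases b <;> assumption

namespace IsGraphCovered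

variable {α β : Type*} [MeasurableSpace α] [MeasurableSpace β]

lemma mono {D D' : Set (α × β)} (h : D ⊆ D') (hD' : IsGraphCovered D') : IsGraphCovered D := by
  obtain ⟨S, hS, hG, hsub⟩ := hD'
  exact ⟨S, hS, hG, h.trans hsub⟩

lemma empty : IsGraphCovered (∅ : Set (α × β)) :=
  ⟨∅, countable_empty, by simp, empty_subset _⟩

lemma of_injOn {D : Set (α × β)} (hD : MeasurableSet D) (h : D.InjOn Prod.fst) :
    IsGraphCovered D :=
  ⟨{D}, countable_singleton D, by simpa using ⟨hD, h⟩, by simp⟩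

lemma iUnion {ι : Type*} [Countable ι] {D : ι → Set (α × β)} (h : ∀ i, IsGraphCovered (D i)) :
    IsGraphCovered (⋃ i, D i) := by
  choose S hS hG hsub using h
  refine ⟨⋃ i, S i, countable_iUnion hS, fun G hG' ↦ ?_, iUnion_subset fun i ↦ (hsub i).trans ?_⟩
  · obtain ⟨i, hi⟩ := mem_iUnion.1 hG'
    exact hG i G hi
  · exact sUnion_subset_sUnion (subset_iUnion S i)

lemma union {D D' : Set (α × β)} (h : IsGraphCovered D) (h' : IsGraphCovered D') :
    IsGraphCovered (D ∪ D') := by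
  rw [union_eq_iUnion]
  exact iUnion (Bool.rec h' h)

lemma exists_measurable_superset {D : Set (α × β)} (h : IsGraphCovered D) :
    ∃ D', D ⊆ D' ∧ MeasurableSet D' ∧ IsGraphCovered D' := by
  obtain ⟨S, hS, hG, hsub⟩ := h
  exact ⟨⋃₀ S, hsub, .sUnion hS fun G h ↦ (hG G h).1, S, hS, hG, Subset.rfl⟩

lemma exists_seq {R : Set (α × β)} (hR : MeasurableSet R) (h : IsGraphCovered R) :
    ∃ G : ℕ → Set (α × β), (∀ n, MeasurableSet (G n)) ∧ (∀ n, (G n).InjOn Prod.fst) ∧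
      Pairwise (Function.onFun Disjoint G) ∧ ⋃ n, G n = R := by
  obtain ⟨S, hS, hG, hsub⟩ := h
  obtain ⟨G, hGS⟩ := (hS.insert ∅).exists_eq_range (insert_nonempty _ _)
  have hprop : ∀ n, MeasurableSet (G n) ∧ (G n).InjOn Prod.fst := fun n ↦ by
    have : G n ∈ insert ∅ S := hGS ▸ mem_range_self n
    rcases this with h | h
    · simp [h]
    · exact hG _ h
  refine ⟨fun n ↦ R ∩ disjointed G n, fun n ↦ hR.inter (.disjointed (fun i ↦ (hprop i).1) n),
    fun n ↦ (hprop n).2.mono (inter_subset_right.trans (disjointed_subset G n)),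
    fun m n hmn ↦ (disjoint_disjointed G hmn).mono inter_subset_right inter_subset_right, ?_⟩
  rw [← inter_iUnion, iUnion_disjointed, inter_eq_left]
  refine hsub.trans fun p ⟨s, hs, hp⟩ ↦ ?_
  obtain ⟨n, rfl⟩ : s ∈ range G := hGS ▸ mem_insert_of_mem _ hs
  exact mem_iUnion.2 ⟨n, hp⟩

end IsGraphCovered

namespace IsLargeFamily

open scoped Classical in
/-- Largeness passes to some member of a countable measurable cover of a piece. -/
lemma exists_insert_of_subset_iUnion {Ω α β ι : Type*} [MeasurableSpace Ω] [MeasurableSpace α]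
    [MeasurableSpace β] {x : Ω → α} {y : Ω → β} [Countable ι] {F : Finset (Set Ω)} {W : Set Ω}
    {V : ι → Set Ω} (h : IsLargeFamily x y (insert W F)) (hV : ∀ i, MeasurableSet (V i))
    (hWV : W ⊆ ⋃ i, V i) : ∃ i, IsLargeFamily x y (insert (V i) F) := by
  by_contra! hcon
  have hF : ∀ W ∈ F, MeasurableSet W := fun W hW ↦ h.1 W (Finset.mem_insert_of_mem hW)
  have hsmall : ∀ i, ∃ D : Set (α × β), IsGraphCovered D ∧
      ∀ a, ∃ U ∈ insert (V i) F, ∀ z ∈ U, x z = a → (a, y z) ∈ D := by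
    intro i
    by_contra! hi
    exact hcon i ⟨by simpa using ⟨hV i, hF⟩, hi⟩
  choose D hD hcov using hsmall
  obtain ⟨a, ha⟩ := h.2 _ (IsGraphCovered.iUnion hD)
  obtain ⟨z, hz, hxz, hyz⟩ := ha W (Finset.mem_insert_self _ _)
  obtain ⟨i, hi⟩ := mem_iUnion.1 (hWV hz)
  obtain ⟨U, hU, hUD⟩ := hcov i a
  rcases Finset.mem_insert.1 hU with rfl | hU
  · exact hyz (mem_iUnion.2 ⟨i, hUD z hi hxz⟩)
  · obtain ⟨z', hz', hxz', hyz'⟩ := ha U (Finset.mem_insert_of_mem hU)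
    exact hyz' (mem_iUnion.2 ⟨i, hUD z' hz' hxz'⟩)

open scoped Classical in
/-- Some coordinate of `y` splits a piece of a large family into two pieces, preserving
largeness. -/
lemma exists_split {Ω α : Type*} [MeasurableSpace Ω] [StandardBorelSpace Ω] [TopologicalSpace α]
    [T2Space α] [SecondCountableTopology α] [MeasurableSpace α] [BorelSpace α]
    {x : Ω → α} {y : Ω → ℕ → Bool} (hx : Measurable x) (hy : Measurable y)
    {F : Finset (Set Ω)} {W : Set Ω} (h : IsLargeFamily x y (insert W F)) :
    ∃ n, IsLargeFamily x y
      (insert (W ∩ {z | y z n = true}) (insert (W ∩ {z | y z n = false}) F)) := by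
  by_contra! hcon
  have hF : ∀ W ∈ F, MeasurableSet W := fun W hW ↦ h.1 W (Finset.mem_insert_of_mem hW)
  have hW : MeasurableSet W := h.1 W (Finset.mem_insert_self _ _)
  have hyn : ∀ n t, MeasurableSet {z | y z n = t} := fun n t ↦
    (measurable_pi_apply n).comp hy (measurableSet_singleton t)
  have hsmall : ∀ n, ∃ D : Set (α × (ℕ → Bool)), IsGraphCovered D ∧
      ∀ a, ∃ U ∈ insert (W ∩ {z | y z n = true}) (insert (W ∩ {z | y z n = false}) F),
        ∀ z ∈ U, x z = a → (a, y z) ∈ D := by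
    intro n
    by_contra! hn
    exact hcon n ⟨by simpa using ⟨hW.inter (hyn n _), hW.inter (hyn n _), hF⟩, hn⟩
  choose D hD hcov using hsmall
  obtain ⟨C, hDC, hCm, hC⟩ := (IsGraphCovered.iUnion hD).exists_measurable_superset
  have hcov' : ∀ n a, ∃ U ∈ insert (W ∩ {z | y z n = true}) (insert (W ∩ {z | y z n = false}) F),
      ∀ z ∈ U, x z = a → (a, y z) ∈ C := fun n a ↦ by
    obtain ⟨U, hU, hUD⟩ := hcov n a
    exact ⟨U, hU, fun z hz hxz ↦ hDC (mem_iUnion.2 ⟨n, hUD z hz hxz⟩)⟩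
  have hCz : MeasurableSet {z | (x z, y z) ∉ C} := (hx.prodMk hy hCm).compl
  let P : ℕ → Bool → Set α := fun n t ↦ x '' (W ∩ {z | y z n = t} ∩ {z | (x z, y z) ∉ C}) ∩
    ⋂ U : (insert W F : Finset (Set Ω)), x '' (U ∩ {z | (x z, y z) ∉ C})
  have hP : ∀ n t, AnalyticSet (P n t) := fun n t ↦ by
    have : Nonempty (insert W F : Finset (Set Ω)) := ⟨W, Finset.mem_insert_self _ _⟩
    have h1 : AnalyticSet (x '' (W ∩ {z | y z n = t} ∩ {z | (x z, y z) ∉ C})) :=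
      ((hW.inter (hyn n t)).inter hCz).analyticSet_image hx
    have h2 : AnalyticSet
        (⋂ U : (insert W F : Finset (Set Ω)), x '' (U ∩ {z | (x z, y z) ∉ C})) :=
      .iInter fun U ↦ ((h.1 U U.2).inter hCz).analyticSet_image hx
    exact h1.inter h2
  have hdisj : ∀ n, Disjoint (P n true) (P n false) := fun n ↦ by
    rw [Set.disjoint_left]
    rintro a ⟨⟨z, ⟨⟨hzW, hzn⟩, hzC⟩, rfl⟩, hall⟩ ⟨⟨z', ⟨⟨hzW', hzn'⟩, hzC'⟩, hxx⟩, -⟩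
    obtain ⟨U, hU, hUC⟩ := hcov' n (x z)
    rcases Finset.mem_insert.1 hU with rfl | hU
    · exact hzC (hUC z ⟨hzW, hzn⟩ rfl)
    rcases Finset.mem_insert.1 hU with rfl | hU
    · exact hzC' (hxx ▸ hUC z' ⟨hzW', hzn'⟩ hxx)
    · obtain ⟨w, ⟨hwU, hwC⟩, hxw⟩ := mem_iInter.1 hall ⟨U, Finset.mem_insert_of_mem hU⟩
      exact hwC (hxw ▸ hUC w hwU hxw)
  have hsep : ∀ n, ∃ S, P n true ⊆ S ∧ Disjoint (P n false) S ∧ MeasurableSet S := fun n ↦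
    (hP n true).measurablySeparable (hP n false) (hdisj n)
  choose S hPS hSd hSm using hsep
  have hgraph : IsGraphCovered {p : α × (ℕ → Bool) | ∀ n, p.1 ∈ S n ↔ p.2 n = true} := by
    refine .of_injOn ?_ ?_
    · rw [ofPred_forall]
      refine .iInter fun n ↦ ?_
      have h1 : MeasurableSet {p : α × (ℕ → Bool) | p.1 ∈ S n} := measurable_fst (hSm n)
      have h2 : MeasurableSet {p : α × (ℕ → Bool) | p.2 n = true} :=
        measurableSet_eq_fun ((measurable_pi_apply n).comp measurable_snd) measurable_const
      exact h1.iff h2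
    · rintro ⟨a, b⟩ hb ⟨a', b'⟩ hb' rfl
      refine Prod.ext rfl (funext fun n ↦ ?_)
      exact Bool.eq_iff_iff.2 ((hb n).symm.trans (hb' n))
  obtain ⟨a, ha⟩ := h.2 _ (hC.union hgraph)
  obtain ⟨z, hzW, rfl, hz⟩ := ha W (Finset.mem_insert_self _ _)
  rw [mem_union, not_or] at hz
  refine hz.2 fun n ↦ ?_
  have hmem : x z ∈ P n (y z n) := by
    refine ⟨⟨z, ⟨⟨hzW, rfl⟩, hz.1⟩, rfl⟩, mem_iInter.2 fun U ↦ ?_⟩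
    obtain ⟨w, hwU, hxw, hw⟩ := ha U U.2
    exact ⟨w, ⟨hwU, fun hc ↦ hw (.inl (hxw ▸ hc))⟩, hxw⟩
  cases ht : y z n with
  | true => simpa [ht] using hPS n (ht ▸ hmem)
  | false => simpa [ht] using Set.disjoint_right.1 (hSd n).symm (ht ▸ hmem)

open scoped Classical in
/-- Refine every piece of a large family into two pieces of small diameter on which `y` takes
different values. -/
lemma exists_refine {α : Type*} [TopologicalSpace α]
    [T2Space α] [SecondCountableTopology α] [MeasurableSpace α] [BorelSpace α]
    {x : (ℕ → ℕ) → α} {y : (ℕ → ℕ) → ℕ → Bool} (hx : Measurable x) (hy : Measurable y) (n : ℕ)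
    (F G : Finset (Set (ℕ → ℕ))) (h : IsLargeFamily x y (F ∪ G)) :
    ∃ F', IsLargeFamily x y (F' ∪ G) ∧ ∀ W ∈ F, ∃ (m : ℕ) (V : Bool → Set (ℕ → ℕ)), ∀ t,
      V t ∈ F' ∧ V t ⊆ W ∧ (∀ z ∈ V t, y z m = t) ∧ ∀ z ∈ V t, ∀ w ∈ V t, z n = w n := by
  induction F using Finset.induction_on generalizing G with
  | empty => exact ⟨∅, h, by simp⟩
  | insert W F _ ih =>
    rw [Finset.insert_union, ← Finset.union_insert] at h
    obtain ⟨F', hF', hsplit⟩ := ih _ h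
    rw [Finset.union_insert] at hF'
    have hW : MeasurableSet W := hF'.1 W (Finset.mem_insert_self _ _)
    obtain ⟨m, hm⟩ := hF'.exists_split hx hy
    have hmeas : ∀ t k, MeasurableSet (W ∩ {z | y z m = t} ∩ {z | z n = k}) := fun t k ↦
      (hW.inter ((measurable_pi_apply m).comp hy (measurableSet_singleton t))).inter
        (measurableSet_eq_fun (measurable_pi_apply n) measurable_const)
    have hcov : ∀ t, W ∩ {z | y z m = t} ⊆ ⋃ k, W ∩ {z | y z m = t} ∩ {z | z n = k} :=
      fun t z hz ↦ mem_iUnion.2 ⟨z n, hz, rfl⟩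
    obtain ⟨k₁, hk₁⟩ := hm.exists_insert_of_subset_iUnion (hmeas true) (hcov true)
    rw [Finset.insert_comm] at hk₁
    obtain ⟨k₀, hk₀⟩ := hk₁.exists_insert_of_subset_iUnion (hmeas false) (hcov false)
    refine ⟨insert (W ∩ {z | y z m = false} ∩ {z | z n = k₀})
      (insert (W ∩ {z | y z m = true} ∩ {z | z n = k₁}) F'), by
        simpa only [Finset.insert_union] using hk₀, fun U hU ↦ ?_⟩
    rcases Finset.mem_insert.1 hU with rfl | hU
    · refine ⟨m, fun t ↦ U ∩ {z | y z m = t} ∩ {z | z n = bif t then k₁ else k₀}, fun t ↦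
        ⟨?_, fun z hz ↦ hz.1.1, fun z hz ↦ hz.1.2, fun z hz w hw ↦ hz.2.trans hw.2.symm⟩⟩
      cases t <;> simp
    · obtain ⟨m', V, hV⟩ := hsplit U hU
      exact ⟨m', V, fun t ↦ ⟨Finset.mem_insert_of_mem (Finset.mem_insert_of_mem (hV t).1),
        (hV t).2⟩⟩

end IsLargeFamily

/-- A large family is not parametrized by a relation with countable vertical sections. -/
lemma IsLargeFamily.exists_uncountable_section {α : Type*} [TopologicalSpace α]
    [T2Space α] [SecondCountableTopology α] [MeasurableSpace α] [BorelSpace α]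
    {x : (ℕ → ℕ) → α} {y : (ℕ → ℕ) → ℕ → Bool} (hx : Continuous x) (hy : Continuous y)
    (h : IsLargeFamily x y {univ}) : ∃ a, ¬ (y '' {z | x z = a}).Countable := by
  classical
  have hrefine := fun (n : ℕ) (F : {F // IsLargeFamily x y F}) ↦
    IsLargeFamily.exists_refine hx.measurable hy.measurable n F.1 ∅ (by simpa using F.2)
  simp only [Finset.union_empty] at hrefine
  choose next hnext hsplit using hrefine
  let F : ℕ → {F // IsLargeFamily x y F} :=
    Nat.rec ⟨{univ}, h⟩ fun n F ↦ ⟨next n F, hnext n F⟩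
  choose m V hV using hsplit
  let node : (ℕ → Bool) → (n : ℕ) → {W // W ∈ (F n).1} := fun b ↦
    Nat.rec ⟨univ, Finset.mem_singleton_self _⟩
      fun n W ↦ ⟨V n (F n) W.1 W.2 (b n), (hV n (F n) W.1 W.2 (b n)).1⟩
  have hnode : ∀ b n, (node b (n + 1)).1 = V n (F n) (node b n).1 (node b n).2 (b n) :=
    fun _ _ ↦ rfl
  have hanti : ∀ b, Antitone fun n ↦ (node b n).1 := fun b ↦
    antitone_nat_of_succ_le fun n ↦ (hV n (F n) _ (node b n).2 (b n)).2.1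
  have hlarge : ∀ n, ∃ a, ∀ W ∈ (F n).1, ∃ z ∈ W, x z = a := fun n ↦ by
    obtain ⟨a, ha⟩ := (F n).2.2 ∅ .empty
    exact ⟨a, fun W hW ↦ (ha W hW).imp fun z hz ↦ ⟨hz.1, hz.2.1⟩⟩
  choose a ha using hlarge
  choose p hpW hpx using fun b n ↦ ha n (node b n).1 (node b n).2
  have hmem : ∀ b n k, n ≤ k → p b k ∈ (node b n).1 := fun b n k hnk ↦ hanti b hnk (hpW b k)
  let q : (ℕ → Bool) → ℕ → ℕ := fun b n ↦ p b (n + 1) n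
  have hlim : ∀ b, Tendsto (p b) atTop (𝓝 (q b)) := fun b ↦ by
    refine tendsto_pi_nhds.2 fun n ↦ tendsto_const_nhds.congr' ?_
    filter_upwards [eventually_ge_atTop (n + 1)] with k hk
    exact (hV n (F n) _ (node b n).2 (b n)).2.2.2 _ (hmem b (n + 1) _ le_rfl) _ (hmem b _ k hk)
  have hxa : ∀ b, Tendsto a atTop (𝓝 (x (q b))) := fun b ↦ by
    simpa only [Function.comp_def, hpx] using (hx.tendsto (q b)).comp (hlim b)
  have hyq : ∀ b n, y (q b) (m n (F n) (node b n).1 (node b n).2) = b n := fun b n ↦ by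
    have h1 := ((continuous_apply (m n (F n) (node b n).1 (node b n).2)).comp hy).tendsto (q b)
    refine tendsto_nhds_unique (h1.comp (hlim b)) (tendsto_const_nhds.congr' ?_)
    filter_upwards [eventually_ge_atTop (n + 1)] with k hk
    exact ((hV n (F n) _ (node b n).2 (b n)).2.2.1 _ (hmem b (n + 1) k hk)).symm
  have hinj : Function.Injective fun b ↦ y (q b) := by
    intro b c hbc
    replace hbc : y (q b) = y (q c) := hbc
    have hstep : ∀ n, node b n = node c n → b n = c n := fun n hn ↦ by
      rw [← hyq b n, ← hyq c n, hbc, hn]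
    have hall : ∀ n, node b n = node c n := by
      intro n
      induction n with
      | zero => rfl
      | succ n ih =>
        refine Subtype.ext ?_
        rw [hnode, hnode, hstep n ih, ih]
    exact funext fun n ↦ hstep n (hall n)
  refine ⟨x (q fun _ ↦ true), fun hc ↦ ?_⟩
  have hsub : range (fun b ↦ y (q b)) ⊆ y '' {z | x z = x (q fun _ ↦ true)} := by
    rintro _ ⟨b, rfl⟩
    exact ⟨q b, tendsto_nhds_unique (hxa b) (hxa _), rfl⟩
  have hcount := (hc.mono hsub).preimage_of_injOn (f := fun b ↦ y (q b)) hinj.injOn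
  rw [preimage_range, countable_univ_iff, ← Cardinal.mk_le_aleph0_iff] at hcount
  simp [Cardinal.aleph0_lt_continuum.not_ge] at hcount

/-- **Lusin–Novikov theorem**: a Borel set with countable vertical sections is a countable
disjoint union of Borel graphs of partial functions. -/
theorem exists_measurable_injOn_fst_iUnion_eq {α β : Type*} [MeasurableSpace α]
    [StandardBorelSpace α] [MeasurableSpace β] [StandardBorelSpace β] {R : Set (α × β)}
    (hR : MeasurableSet R) (hc : ∀ a, {b | (a, b) ∈ R}.Countable) :
    ∃ G : ℕ → Set (α × β), (∀ n, MeasurableSet (G n)) ∧ (∀ n, (G n).InjOn Prod.fst) ∧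
      Pairwise (Function.onFun Disjoint G) ∧ ⋃ n, G n = R := by
  refine IsGraphCovered.exists_seq hR ?_
  let := upgradeStandardBorel α
  let e : β → ℕ → Bool := MeasurableSpace.mapNatBool β
  have he : Measurable e := MeasurableSpace.measurable_mapNatBool β
  have hinj : Function.Injective e := MeasurableSpace.injective_mapNatBool β
  have hf : Measurable (Prod.map id e : α × β → α × (ℕ → Bool)) := measurable_id.prodMap he
  suffices hcov : IsGraphCovered (Prod.map id e '' R) by
    obtain ⟨S, hS, hG, hsub⟩ := hcov
    refine ⟨preimage (Prod.map id e) '' S, hS.image _, ?_, fun p hp ↦ ?_⟩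
    · rintro _ ⟨G, hGS, rfl⟩
      refine ⟨hf (hG G hGS).1, fun p hp q hq hpq ↦ Prod.ext hpq (hinj ?_)⟩
      exact congrArg Prod.snd ((hG G hGS).2 hp hq hpq)
    · obtain ⟨G, hGS, hpG⟩ := hsub (mem_image_of_mem _ hp)
      exact ⟨_, mem_image_of_mem _ hGS, hpG⟩
  have han : AnalyticSet (Prod.map id e '' R) := hR.analyticSet_image hf
  rw [AnalyticSet] at han
  obtain h0 | ⟨φ, hφ, hrange⟩ := han
  · exact h0 ▸ .empty
  by_contra hnot
  have hlarge : IsLargeFamily (fun z ↦ (φ z).1) (fun z ↦ (φ z).2) {univ} := by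
    refine ⟨by simp, fun D hD ↦ ?_⟩
    by_contra! hcon
    refine hnot (hD.mono ?_)
    rw [← hrange]
    rintro _ ⟨z, rfl⟩
    obtain ⟨W, hW, hWz⟩ := hcon (φ z).1
    rw [Finset.mem_singleton] at hW
    exact hWz z (hW ▸ mem_univ z) rfl
  obtain ⟨a, ha⟩ := hlarge.exists_uncountable_section (continuous_fst.comp hφ)
    (continuous_snd.comp hφ)
  refine ha (((hc a).image e).mono ?_)
  rintro _ ⟨z, rfl, rfl⟩
  obtain ⟨⟨a', b⟩, hab, heq⟩ : φ z ∈ Prod.map id e '' R := hrange ▸ mem_range_self z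
  exact ⟨b, by simpa [← heq] using hab, by simp [← heq]⟩

section CountableSections

variable {α β : Type*} [MeasurableSpace α] [StandardBorelSpace α] [MeasurableSpace β]
  [StandardBorelSpace β] {R : Set (α × β)}

lemma measurableSet_image_fst_of_countable (hR : MeasurableSet R)
    (hc : ∀ a, {b | (a, b) ∈ R}.Countable) : MeasurableSet (Prod.fst '' R) := by
  obtain ⟨G, hG, hinj, -, rfl⟩ := exists_measurable_injOn_fst_iUnion_eq hR hc
  rw [image_iUnion]
  exact .iUnion fun n ↦ (hG n).image_of_measurable_injOn measurable_fst (hinj n)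

lemma measurableSet_exists_mem_of_countable (hR : MeasurableSet R)
    (hc : ∀ a, {b | (a, b) ∈ R}.Countable) {S : Set β} (hS : MeasurableSet S) :
    MeasurableSet {a | ∃ b ∈ S, (a, b) ∈ R} := by
  convert measurableSet_image_fst_of_countable (hR.inter (measurable_snd hS))
    fun a ↦ (hc a).mono fun b hb ↦ hb.1
  ext a
  simp [and_comm]

lemma measurableSet_infinite_section_of_countable (hR : MeasurableSet R)
    (hc : ∀ a, {b | (a, b) ∈ R}.Countable) :
    MeasurableSet {a | {b | (a, b) ∈ R}.Infinite} := by
  obtain ⟨G, hG, hinj, hdisj, rfl⟩ := exists_measurable_injOn_fst_iUnion_eq hR hc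
  have key : ∀ a, {b | (a, b) ∈ ⋃ n, G n}.Infinite ↔ ∀ N, ∃ n, N ≤ n ∧ a ∈ Prod.fst '' G n := by
    intro a
    rw [← frequently_atTop, Nat.frequently_atTop_iff_infinite, not_iff_not.symm, not_infinite,
      not_infinite]
    constructor <;> intro hfin
    · refine (hfin.biUnion (t := fun b ↦ {n | (a, b) ∈ G n}) fun b _ ↦
        Set.Subsingleton.finite fun n hn m hm ↦ ?_).subset ?_
      · by_contra hne
        exact Set.disjoint_left.1 (hdisj hne) hn hm
      · rintro n ⟨⟨a', b⟩, hb, rfl⟩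
        exact mem_biUnion (x := b) (mem_iUnion.2 ⟨n, hb⟩) hb
    · refine (hfin.biUnion (t := fun n ↦ {b | (a, b) ∈ G n}) fun n _ ↦
        Set.Subsingleton.finite fun b hb b' hb' ↦ ?_).subset ?_
      · exact congrArg Prod.snd (hinj n hb hb' rfl)
      · intro b hb
        obtain ⟨n, hn⟩ := mem_iUnion.1 hb
        exact mem_biUnion (x := n) ⟨_, hn, rfl⟩ hn
  simp only [key, ofPred_forall, ofPred_exists]
  exact .iInter fun N ↦ .iUnion fun n ↦ (MeasurableSet.const _).inter
    ((hG n).image_of_measurable_injOn measurable_fst (hinj n))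

end CountableSections

section Graph

variable {X : Type*} [MeasurableSpace X] [StandardBorelSpace X] {Γ : Set (X × X)}

/-- A locally finite Borel graph has a countable Borel coloring. -/
lemma IsBorelGraph.exists_measurable_coloring (hΓ : IsBorelGraph Γ)
    (hloc : ∀ x, {y | (x, y) ∈ Γ}.Finite) :
    ∃ c : X → ℕ, Measurable c ∧ ∀ x y, (x, y) ∈ Γ → c x ≠ c y := by
  classical
  let := upgradeStandardBorel X
  obtain ⟨U, hU⟩ := ((TopologicalSpace.countable_countableBasis X).insert ∅).exists_eq_range
    (insert_nonempty _ _)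
  have hopen : ∀ n, IsOpen (U n) := fun n ↦ by
    have : U n ∈ insert ∅ (TopologicalSpace.countableBasis X) := hU ▸ mem_range_self n
    rcases this with h | h
    · simp [h]
    · exact TopologicalSpace.isOpen_of_mem_countableBasis h
  have hex : ∀ x, ∃ n, x ∈ U n ∧ ¬ ∃ y ∈ U n, (x, y) ∈ Γ := fun x ↦ by
    obtain ⟨V, hV, hxV, hsub⟩ :=
      (TopologicalSpace.isBasis_countableBasis X).exists_subset_of_mem_open
        (show x ∈ {y | (x, y) ∈ Γ}ᶜ from hΓ.2.2 x) (hloc x).isClosed.isOpen_compl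
    obtain ⟨n, rfl⟩ : V ∈ range U := hU ▸ mem_insert_of_mem _ hV
    exact ⟨n, hxV, fun ⟨y, hy, hxy⟩ ↦ hsub hy hxy⟩
  refine ⟨fun x ↦ Nat.find (hex x), measurable_find hex fun n ↦ ?_, fun x y hxy heq ↦ ?_⟩
  · exact (hopen n).measurableSet.inter (measurableSet_exists_mem_of_countable hΓ.1
      (fun a ↦ (hloc a).countable) (hopen n).measurableSet).compl
  · replace heq : Nat.find (hex x) = Nat.find (hex y) := heq
    exact (Nat.find_spec (hex x)).2 ⟨y, heq ▸ (Nat.find_spec (hex y)).1, hxy⟩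

/-- In a locally finite Borel graph, every Borel independent subset of a Borel set `B` extends to
a Borel independent subset of `B` that is maximal. -/
lemma IsBorelGraph.exists_maximal_independent (hΓ : IsBorelGraph Γ)
    (hloc : ∀ x, {y | (x, y) ∈ Γ}.Finite) {C B : Set X} (hC : MeasurableSet C)
    (hB : MeasurableSet B) (hCB : C ⊆ B) (hind : ∀ x ∈ C, ∀ y ∈ C, (x, y) ∉ Γ) :
    ∃ M, MeasurableSet M ∧ C ⊆ M ∧ M ⊆ B ∧ (∀ x ∈ M, ∀ y ∈ M, (x, y) ∉ Γ) ∧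
      ∀ x ∈ B, x ∉ M → ∃ y ∈ M, (x, y) ∈ Γ := by
  obtain ⟨c, hc, hcΓ⟩ := hΓ.exists_measurable_coloring hloc
  let M : ℕ → Set X :=
    Nat.rec C fun k M ↦ M ∪ (B ∩ c ⁻¹' {k} ∩ {x | ∃ y ∈ M, (x, y) ∈ Γ}ᶜ)
  have hsucc : ∀ k, M (k + 1) = M k ∪ (B ∩ c ⁻¹' {k} ∩ {x | ∃ y ∈ M k, (x, y) ∈ Γ}ᶜ) :=
    fun _ ↦ rfl
  have hmono : Monotone M := monotone_nat_of_le_succ fun k ↦ subset_union_left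
  have hM : ∀ k, MeasurableSet (M k) ∧ M k ⊆ B ∧ ∀ x ∈ M k, ∀ y ∈ M k, (x, y) ∉ Γ := by
    intro k
    induction k with
    | zero => exact ⟨hC, hCB, hind⟩
    | succ k ih =>
      rw [hsucc]
      refine ⟨ih.1.union ((hB.inter (hc (measurableSet_singleton k))).inter
        (measurableSet_exists_mem_of_countable hΓ.1 (fun a ↦ (hloc a).countable) ih.1).compl),
        union_subset ih.2.1 fun x hx ↦ hx.1.1, ?_⟩
      rintro x (hx | ⟨⟨-, hx⟩, hxM⟩) y (hy | ⟨⟨-, hy⟩, hyM⟩) hxy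
      · exact ih.2.2 x hx y hy hxy
      · exact hyM ⟨x, hx, hΓ.2.1 _ _ hxy⟩
      · exact hxM ⟨y, hy, hxy⟩
      · exact hcΓ x y hxy (hx.trans hy.symm)
  refine ⟨⋃ k, M k, .iUnion fun k ↦ (hM k).1, subset_iUnion M 0, iUnion_subset fun k ↦ (hM k).2.1,
    fun x hx y hy ↦ ?_, fun x hxB hx ↦ ?_⟩
  · obtain ⟨k, hk⟩ := mem_iUnion.1 hx
    obtain ⟨l, hl⟩ := mem_iUnion.1 hy
    exact (hM (max k l)).2.2 x (hmono (le_max_left k l) hk) y (hmono (le_max_right k l) hl)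
  · by_contra! hcon
    refine hx (mem_iUnion.2 ⟨c x + 1, .inr ⟨⟨hxB, rfl⟩, fun ⟨y, hy, hxy⟩ ↦ ?_⟩⟩)
    exact hcon y (mem_iUnion.2 ⟨_, hy⟩) hxy

/-- Disjoint Borel independent sets extend to the color classes of a Borel coloring. -/
lemma IsBorelGraph.exists_coloring_extending (hΓ : IsBorelGraph Γ)
    (hloc : ∀ x, {y | (x, y) ∈ Γ}.Finite) {C : ℕ → Set X} (hC : ∀ n, MeasurableSet (C n))
    (hdisj : Pairwise (Function.onFun Disjoint C))
    (hind : ∀ n, ∀ x ∈ C n, ∀ y ∈ C n, (x, y) ∉ Γ) :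
    ∃ f : X → ℕ, Measurable f ∧ (∀ x y, (x, y) ∈ Γ → f x ≠ f y) ∧ ∀ n, C n ⊆ f ⁻¹' {n} := by
  classical
  have hcompl : ∀ (n : ℕ) (P : {P : Set X // MeasurableSet P}),
      MeasurableSet ((P.1 ∪ ⋃ k ∈ {k | k ≠ n}, C k)ᶜ ∪ C n) := fun n P ↦
    (P.2.union (.biUnion (to_countable _) fun k _ ↦ hC k)).compl.union (hC n)
  choose ext hext_meas hext_sub hext_le hext_ind hext_max using
    fun (n : ℕ) (P : {P : Set X // MeasurableSet P}) ↦
      hΓ.exists_maximal_independent hloc (hC n) (hcompl n P) subset_union_right (hind n)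
  let P : ℕ → {P : Set X // MeasurableSet P} :=
    Nat.rec ⟨∅, .empty⟩ fun n P ↦ ⟨P.1 ∪ ext n P, P.2.union (hext_meas n P)⟩
  let D : ℕ → Set X := fun n ↦ ext n (P n)
  have hPsucc : ∀ n, (P (n + 1)).1 = (P n).1 ∪ D n := fun _ ↦ rfl
  have hP : ∀ n x, x ∈ (P n).1 ↔ ∃ m < n, x ∈ D m := by
    intro n x
    induction n with
    | zero => simp [P]
    | succ n ih =>
      rw [hPsucc, mem_union, ih]
      simp only [Nat.lt_succ_iff_lt_or_eq, or_and_right, exists_or, exists_eq_left]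
  have hDC : ∀ n k x, x ∈ D n → x ∈ C k → k = n := fun n k x hx hxk ↦ by
    by_contra hkn
    rcases hext_le n (P n) hx with h | h
    · exact h (.inr (mem_biUnion hkn hxk))
    · exact Set.disjoint_left.1 (hdisj hkn) hxk h
  have hDlt : ∀ m n x, m < n → x ∈ D m → x ∉ D n := fun m n x hmn hm hn ↦ by
    rcases hext_le n (P n) hn with h | h
    · exact h (.inl ((hP n x).2 ⟨m, hmn, hm⟩))
    · exact hmn.ne' (hDC m n x hm h)
  have hDeq : ∀ m n x, x ∈ D m → x ∈ D n → m = n := fun m n x hm hn ↦ by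
    rcases lt_trichotomy m n with h | h | h
    · exact absurd hn (hDlt m n x h hm)
    · exact h
    · exact absurd hm (hDlt n m x h hn)
  have hcov : ∀ x, ∃ n, x ∈ D n := by
    intro x
    by_contra! hx
    have hnbr : ∀ n, ∃ y ∈ D n, (x, y) ∈ Γ := fun n ↦ by
      refine hext_max n (P n) x (.inl ?_) (hx n)
      rintro (h | h)
      · obtain ⟨m, -, hm⟩ := (hP n x).1 h
        exact hx m hm
      · obtain ⟨k, -, hk⟩ := mem_iUnion₂.1 h
        exact hx k (hext_sub k (P k) hk)
    choose y hyD hxy using hnbr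
    refine infinite_of_injective_forall_mem (f := y) (fun m n hmn ↦ ?_) hxy (hloc x)
    exact hDeq m n (y m) (hyD m) (hmn ▸ hyD n)
  refine ⟨fun x ↦ Nat.find (hcov x), measurable_find hcov fun n ↦ hext_meas n (P n),
    fun x y hxy heq ↦ ?_, fun n x hx ↦ ?_⟩
  · replace heq : Nat.find (hcov x) = Nat.find (hcov y) := heq
    exact hext_ind _ _ x (Nat.find_spec (hcov x)) y (heq ▸ Nat.find_spec (hcov y)) hxy
  · exact hDeq _ _ x (Nat.find_spec (hcov x)) (hext_sub n (P n) hx)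

end Graph

section Aperiodic

lemma IsCtblBorelEqvRel.setOf_mem_eq {X : Type*} [MeasurableSpace X] {E : Set (X × X)}
    (hE : IsCtblBorelEqvRel E) {x y : X} (hxy : (x, y) ∈ E) :
    {z | (x, z) ∈ E} = {z | (y, z) ∈ E} :=
  Set.ext fun _ ↦ ⟨hE.2.1.trans (hE.2.1.symm hxy), hE.2.1.trans hxy⟩

variable {X : Type*} [MeasurableSpace X] [StandardBorelSpace X] {E : Set (X × X)}

/-- An aperiodic countable Borel equivalence relation admits a Borel function to `ℕ` taking
infinitely many values on every class. -/
lemma IsCtblBorelEqvRel.exists_measurable_infinite_image (hE : IsCtblBorelEqvRel E)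
    (haper : ∀ x, {y | (x, y) ∈ E}.Infinite) :
    ∃ l : X → ℕ, Measurable l ∧ ∀ x, (l '' {y | (x, y) ∈ E}).Infinite := by
  classical
  obtain ⟨U, hU, hsep⟩ := exists_seq_separating X MeasurableSet.univ (univ : Set X)
  let I : Set X → Set X := fun S ↦ {x | ({y | (x, y) ∈ E} ∩ S).Infinite}
  have hI : ∀ S, MeasurableSet S → MeasurableSet (I S) := fun S hS ↦
    measurableSet_infinite_section_of_countable (R := E ∩ Prod.snd ⁻¹' S)
      (hE.1.inter (measurable_snd hS)) fun a ↦ (hE.2.2 a).mono fun b hb ↦ hb.1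
  have hIinv : ∀ S {x y}, (x, y) ∈ E → (x ∈ I S ↔ y ∈ I S) := fun S x y hxy ↦ by
    simp only [I, mem_ofPred_eq, hE.setOf_mem_eq hxy]
  let A : ℕ → Set X :=
    Nat.rec univ fun n A ↦ ((A ∩ U n) ∩ I (A ∩ U n)) ∪ ((A \ U n) ∩ (I (A ∩ U n))ᶜ)
  have hsucc : ∀ n, A (n + 1) =
      ((A n ∩ U n) ∩ I (A n ∩ U n)) ∪ ((A n \ U n) ∩ (I (A n ∩ U n))ᶜ) := fun _ ↦ rfl
  have hzero : A 0 = univ := rfl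
  clear_value A
  have hA : ∀ n, MeasurableSet (A n) := by
    intro n
    induction n with
    | zero => exact hzero ▸ .univ
    | succ n ih =>
      rw [hsucc]
      have h := ih.inter (hU n)
      exact (h.inter (hI _ h)).union ((ih.diff (hU n)).inter (hI _ h).compl)
  have hanti : Antitone A := antitone_nat_of_succ_le fun n x hx ↦ by
    rcases hsucc n ▸ hx with hx | hx
    exacts [hx.1.1, hx.1.1]
  have hAinf : ∀ n x, ({y | (x, y) ∈ E} ∩ A n).Infinite := by
    intro n x
    induction n with
    | zero => simpa [hzero] using haper x
    | succ n ih =>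
      rw [hsucc]
      by_cases hx : x ∈ I (A n ∩ U n)
      · exact Set.Infinite.mono (fun y hy ↦ ⟨hy.1, .inl ⟨hy.2, (hIinv _ hy.1).1 hx⟩⟩) hx
      · refine (ih.sdiff (not_infinite.1 hx)).mono fun y hy ↦ ⟨hy.1.1, .inr ⟨⟨hy.1.2, ?_⟩, ?_⟩⟩
        · exact fun hyU ↦ hy.2 ⟨hy.1.1, hy.1.2, hyU⟩
        · exact fun hyI ↦ hx ((hIinv _ hy.1.1).2 hyI)
  have hsub : ∀ x y, (x, y) ∈ E → (∀ n, x ∈ A n) → (∀ n, y ∈ A n) → x = y := by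
    intro x y hxy hx hy
    refine hsep x (mem_univ x) y (mem_univ y) fun n ↦ ?_
    have hinv := hIinv (A n ∩ U n) hxy
    rcases hsucc n ▸ hx (n + 1) with h | h <;> rcases hsucc n ▸ hy (n + 1) with h' | h'
    · exact iff_of_true h.1.2 h'.1.2
    · exact absurd (hinv.1 h.2) h'.2
    · exact absurd (hinv.2 h'.2) h.2
    · exact iff_of_false h.1.2 h'.1.2
  have hex : ∀ x, ∃ n, x ∉ A n ∨ ((∀ k, x ∈ A k) ∧ n = 0) := fun x ↦ by
    by_cases h : ∀ k, x ∈ A k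
    · exact ⟨0, .inr ⟨h, rfl⟩⟩
    · exact (not_forall.1 h).imp fun n hn ↦ .inl hn
  refine ⟨fun x ↦ Nat.find (hex x), measurable_find hex fun n ↦ ?_, fun x ↦ ?_⟩
  · have hall : MeasurableSet {x | ∀ k, x ∈ A k} := by
      rw [ofPred_forall]
      exact .iInter hA
    exact (hA n).compl.union (hall.inter (.const _))
  · refine infinite_of_not_bddAbove fun ⟨N, hN⟩ ↦ ?_
    obtain ⟨y, ⟨hy, hyA⟩, z, ⟨hz, hzA⟩, hyz⟩ := (hAinf N x).nontrivial
    have hgt : ∀ w, (x, w) ∈ E → w ∈ A N → ∀ k, w ∈ A k := by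
      intro w hw hwA
      by_contra hk
      have hle : Nat.find (hex w) ≤ N := hN (mem_image_of_mem _ hw)
      rcases Nat.find_spec (hex w) with h | h
      · exact h (hanti hle hwA)
      · exact hk h.1
    exact hyz (hsub y z (hE.2.1.trans (hE.2.1.symm hy) hz) (hgt y hy hyA) (hgt z hz hzA))

/-- An aperiodic countable Borel equivalence relation admits a Borel function to `ℕ` taking every
value infinitely often on every class. -/
lemma IsCtblBorelEqvRel.exists_measurable_infinite_fibers (hE : IsCtblBorelEqvRel E)
    (haper : ∀ x, {y | (x, y) ∈ E}.Infinite) :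
    ∃ h : X → ℕ, Measurable h ∧ ∀ x i, ({y | (x, y) ∈ E} ∩ h ⁻¹' {i}).Infinite := by
  classical
  obtain ⟨l, hl, hlinf⟩ := hE.exists_measurable_infinite_image haper
  let p : X → ℕ → Prop := fun x m ↦ ∃ y ∈ l ⁻¹' {m}, (x, y) ∈ E
  have hp : ∀ m, MeasurableSet {x | p x m} := fun m ↦
    measurableSet_exists_mem_of_countable hE.1 hE.2.2 (hl (measurableSet_singleton m))
  have hpinv : ∀ x y, (x, y) ∈ E → p x = p y := fun x y hxy ↦ funext fun m ↦ propext
    ⟨fun ⟨z, hz, h⟩ ↦ ⟨z, hz, hE.2.1.trans (hE.2.1.symm hxy) h⟩,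
      fun ⟨z, hz, h⟩ ↦ ⟨z, hz, hE.2.1.trans hxy h⟩⟩
  have hcount : ∀ k, Measurable fun x ↦ Nat.count (p x) k := by
    intro k
    induction k with
    | zero => simp
    | succ k ih =>
      simp only [Nat.count_succ]
      exact ih.add (.ite (hp k) measurable_const measurable_const)
  have hrank : Measurable fun x ↦ Nat.count (p x) (l x) :=
    (measurable_from_prod_countable_left (f := fun q : X × ℕ ↦ Nat.count (p q.1) q.2) hcount).comp
      (measurable_id.prodMk hl)
  have hsurj : ∀ x k, ∃ y, (x, y) ∈ E ∧ Nat.count (p y) (l y) = k := fun x k ↦ by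
    have hinf : {m | p x m}.Infinite := by
      refine (hlinf x).mono ?_
      rintro m ⟨y, hy, hm⟩
      exact ⟨y, hm, hy⟩
    obtain ⟨y, hy, hxy⟩ := Nat.nth_mem_of_infinite hinf k
    refine ⟨y, hxy, ?_⟩
    rw [← hpinv x y hxy, show l y = Nat.nth (p x) k from hy, Nat.count_nth_of_infinite hinf]
  refine ⟨fun x ↦ (Nat.unpair (Nat.count (p x) (l x))).1,
    (measurable_from_nat (f := fun n ↦ (Nat.unpair n).1)).comp hrank, fun x i ↦ ?_⟩
  choose y hy hyk using fun j ↦ hsurj x (Nat.pair i j)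
  refine infinite_of_injective_forall_mem (f := y) (fun j j' hjj ↦ ?_) fun j ↦ ⟨hy j, ?_⟩
  · have := (hyk j).symm.trans (hjj ▸ hyk j')
    exact (Nat.pair_eq_pair.1 this).2
  · simp [hyk]

end Aperiodic

end BorelCombinatorics

/-- If `E` is an aperiodic countable Borel equivalence relation on a standard Borel space and
`Γ ⊆ E` is a locally finite Borel graph, then there is a Borel `Γ`-coloring `f : X → ℕ` such
that every `E`-class meets every color class `f⁻¹(i)` in an infinite set. -/
theorem exists_borel_coloring_infinite_in_classes
    {X : Type*} [MeasurableSpace X] [StandardBorelSpace X]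
    (E : Set (X × X)) (hE : IsCtblBorelEqvRel E)
    (haper : ∀ x : X, {y | (x, y) ∈ E}.Infinite)
    (Γ : Set (X × X)) (hΓ : IsBorelGraph Γ) (hΓE : Γ ⊆ E)
    (hloc : ∀ x : X, {y | (x, y) ∈ Γ}.Finite) :
    ∃ f : X → ℕ, Measurable f ∧
      (∀ x y : X, (x, y) ∈ Γ → f x ≠ f y) ∧
      ∀ (x : X) (i : ℕ), ({y | (x, y) ∈ E} ∩ f ⁻¹' {i}).Infinite := by
  obtain ⟨h, hh, hinf⟩ := hE.exists_measurable_infinite_fibers haper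
  choose C hC _ hCh hind hmax using fun n ↦ hΓ.exists_maximal_independent hloc .empty
    (hh (measurableSet_singleton n)) (Set.empty_subset _) (by simp)
  have hdisj : Pairwise (Function.onFun Disjoint C) := fun m n hmn ↦
    Set.disjoint_left.2 fun x hm hn ↦ hmn ((hCh m hm).symm.trans (hCh n hn))
  obtain ⟨f, hf, hcol, hCf⟩ := hΓ.exists_coloring_extending hloc hC hdisj hind
  refine ⟨f, hf, hcol, fun x i ↦ ?_⟩
  refine Set.Infinite.mono (Set.inter_subset_inter_right _ (hCf i)) fun hfin ↦ hinf x i ?_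
  refine (hfin.union (hfin.biUnion fun y _ ↦ hloc y)).subset fun z ⟨hz, hzi⟩ ↦ ?_
  by_cases hzC : z ∈ C i
  · exact .inl ⟨hz, hzC⟩
  · obtain ⟨y, hy, hzy⟩ := hmax i z hzi hzC
    exact .inr (Set.mem_biUnion (x := y) ⟨hE.2.1.trans hz (hΓE hzy), hy⟩ (hΓ.2.1 _ _ hzy))
end
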